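/- arXiv:2410.04024 — 3 statements merged into one kernel-verified Lean document; each statement's English description precedes it below -/
import Mathlib

section
/- Let F be the finite field of order 81, let δ ∈ F have multiplicative order 8 (so δ generates the multiplicative group of the subfield with 9 elements), and let α ∈ F satisfy α² = δ, chosen so that the squares of F among {x + α : x ∈ F_9} are exactly {α+δ, α+δ², α+δ⁵, α+δ⁶}. Set C_9 := {0, 1, δ, α+δ⁵, δ·(α+δ⁵)}. Then C_9 is a maximal clique of size 5 in the Paley graph P(81), and the setwise stabilizer of C_9 in the automorphism group of P(81) consists exactly of the identity and the map γ ↦ (α+δ⁵)·γ⁹; in particular it is cyclic of order 2. -/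
/-- A subset `C` of a field is a clique in the Paley graph: any two distinct
elements differ by a nonzero square. -/
def IsPaleyClique {F : Type*} [Field F] (C : Set F) : Prop :=
  ∀ a ∈ C, ∀ b ∈ C, a ≠ b → IsSquare (a - b)

/-- A maximal clique in the Paley graph. -/
def IsMaximalPaleyClique {F : Type*} [Field F] (C : Set F) : Prop :=
  IsPaleyClique C ∧ ∀ D : Set F, IsPaleyClique D → C ⊆ D → D = C

/-- A bijection of the field is an automorphism of the Paley graph if it
preserves the adjacency relation. -/
def IsPaleyAut {F : Type*} [Field F] (f : Equiv.Perm F) : Prop :=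
  ∀ a b : F, (f a ≠ f b ∧ IsSquare (f a - f b)) ↔ (a ≠ b ∧ IsSquare (a - b))

/-- The setwise stabilizer of a vertex subset `C` inside the automorphism
group of the Paley graph. -/
def paleyStab {F : Type*} [Field F] (C : Set F) : Set (Equiv.Perm F) :=
  {f | IsPaleyAut f ∧ ⇑f '' C = C}

/-- The orbit of a vertex subset `C` under the natural action of the
automorphism group of the Paley graph on vertex subsets. -/
def paleyOrbit {F : Type*} [Field F] (C : Set F) : Set (Set F) :=
  {D | ∃ f : Equiv.Perm F, IsPaleyAut f ∧ ⇑f '' C = D}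

section Signature

variable {V : Type*}

/-- The adjacencies of `v` to the five vertices `t`, read as binary digits. -/
def adjacencyCode (A : V → V → Bool) (t : Fin 5 → V) (v : V) : ℕ :=
  ∑ i, if A (t i) v then 2 ^ i.val else 0

/-- One round of colour refinement, started from `adjacencyCode`. -/
def signature [Fintype V] (A : V → V → Bool) (t : Fin 5 → V) (v : V) : ℕ :=
  adjacencyCode A t v + 32 * ∑ w, if A v w then adjacencyCode A t w ^ 3 else 0

/-- The number of common neighbours of `a`, `b` and `c`. -/
def commonNeighborCount [Fintype V] (A : V → V → Bool) (a b c : V) : ℕ :=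
  ∑ v, if A a v && A b v && A c v then 1 else 0

/-- No vertex with adjacency code `m` is adjacent to one with adjacency code `n`. -/
def NoEdgeBetween (A : V → V → Bool) (t : Fin 5 → V) (m n : ℕ) : Prop :=
  ∀ v, adjacencyCode A t v = m → ∀ w, adjacencyCode A t w = n → A v w = false

instance [Fintype V] (A : V → V → Bool) (t : Fin 5 → V) (m n : ℕ) :
    Decidable (NoEdgeBetween A t m n) :=
  inferInstanceAs (Decidable (∀ _, _ → ∀ _, _ → _))

variable {A : V → V → Bool} {g : Equiv.Perm V}

theorem adjacencyCode_comp (hg : ∀ v w, A (g v) (g w) = A v w) (t : Fin 5 → V) (v : V) :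
    adjacencyCode A (g ∘ t) (g v) = adjacencyCode A t v := by
  simp [adjacencyCode, hg]

theorem signature_comp [Fintype V] (hg : ∀ v w, A (g v) (g w) = A v w) (t : Fin 5 → V) (v : V) :
    signature A (g ∘ t) (g v) = signature A t v := by
  unfold signature
  rw [adjacencyCode_comp hg, ← Equiv.sum_comp g]
  simp [hg, adjacencyCode_comp hg]

theorem commonNeighborCount_map [Fintype V] (hg : ∀ v w, A (g v) (g w) = A v w) (a b c : V) :
    commonNeighborCount A (g a) (g b) (g c) = commonNeighborCount A a b c := by
  unfold commonNeighborCount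
  rw [← Equiv.sum_comp g]
  simp [hg]

theorem NoEdgeBetween.comp (hg : ∀ v w, A (g v) (g w) = A v w) {t : Fin 5 → V} {m n : ℕ}
    (h : NoEdgeBetween A t m n) : NoEdgeBetween A (g ∘ t) m n := by
  intro v hv w hw
  obtain ⟨v, rfl⟩ := g.surjective v
  obtain ⟨w, rfl⟩ := g.surjective w
  rw [adjacencyCode_comp hg] at hv hw
  rw [hg, h v hv w hw]

end Signature

/-- Coordinates with respect to the basis `1, α, α², α³` of `𝔽₃(α)`, where `α⁴ = α² + 1`. -/
abbrev Coord := ZMod 3 × ZMod 3 × ZMod 3 × ZMod 3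

namespace Coord

/-- The multiplication of `𝔽₃[X] / (X⁴ - X² - 1)` in coordinates. -/
def mul (v w : Coord) : Coord :=
  let (a, b, c, d) := v
  let (a', b', c', d') := w
  let p₄ := b * d' + c * c' + d * b'
  let p₅ := c * d' + d * c'
  let p₆ := d * d'
  (a * a' + p₄ + p₆, a * b' + b * a' + p₅, a * c' + b * b' + c * a' + p₄ + 2 * p₆,
    a * d' + b * c' + c * b' + d * a' + p₅)

/-- The cube of `v`. -/
def cube (v : Coord) : Coord :=
  mul v (mul v v)

/-- The number with base `3` digits `v`. -/
def index (v : Coord) : ℕ :=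
  v.1.val + 3 * v.2.1.val + 9 * v.2.2.1.val + 27 * v.2.2.2.val

/-- Adjacency in the Paley graph of order `81`; the binary digits of the numeral mark the
nonzero squares. -/
def adj (v w : Coord) : Bool :=
  Nat.testBit 673074136270519970676230 (index (v - w))

/-- The five vertices of the clique `C₉`. -/
def clique : Fin 5 → Coord :=
  ![(0, 0, 0, 0), (1, 0, 0, 0), (0, 0, 1, 0), (0, 1, 2, 0), (2, 0, 2, 1)]

theorem adj_zero_iff (v : Coord) : adj v 0 = true ↔ v ≠ 0 ∧ ∃ u, mul u u = v := by
  revert v; decide +kernel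

theorem exists_mul_eq_one (v : Coord) (hv : v ≠ 0) : ∃ w, mul v w = (1, 0, 0, 0) := by
  revert v; decide +kernel

theorem exists_not_adj_clique (v : Coord) : ∃ i, adj (clique i) v = false := by
  revert v; decide +kernel

theorem adj_clique (i j : Fin 5) (h : i ≠ j) : adj (clique i) (clique j) = true := by
  revert i j; decide +kernel

theorem clique_injective : Function.Injective clique := by
  decide +kernel

theorem mul_cube_cube_clique (i : Fin 5) :
    mul (clique 3) (cube (cube (clique i))) =
      clique ((![0, 3, 4, 1, 2] : Fin 5 → Fin 5) i) := by
  revert i; decide +kernel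

theorem signature_clique_injective : Function.Injective (signature adj clique) := by
  decide +kernel

theorem commonNeighborCount_clique_zero_three_four :
    commonNeighborCount adj (clique 0) (clique 3) (clique 4) = 10 := by
  decide +kernel

theorem commonNeighborCount_clique_zero_one_two :
    commonNeighborCount adj (clique 0) (clique 1) (clique 2) = 10 := by
  decide +kernel

theorem noEdgeBetween_clique : NoEdgeBetween adj clique 4 11 := by
  decide +kernel

theorem eq_of_commonNeighborCount_of_noEdgeBetween (a b c d e : Fin 5) :
    a ≠ b → a ≠ c → b ≠ c →
    commonNeighborCount adj (clique a) (clique b) (clique c) = 10 →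
    a ≠ d → b ≠ d → c ≠ d → a ≠ e → b ≠ e → c ≠ e → d ≠ e →
    commonNeighborCount adj (clique a) (clique d) (clique e) = 10 →
    NoEdgeBetween adj (clique ∘ ![a, b, c, d, e]) 4 11 →
    ![a, b, c, d, e] = ![0, 1, 2, 3, 4] ∨ ![a, b, c, d, e] = ![0, 3, 4, 1, 2] := by
  revert a b c d e
  decide +kernel

variable {g : Equiv.Perm Coord}

theorem eq_one_of_fixes_clique (hg : ∀ v w, adj (g v) (g w) = adj v w)
    (hc : ∀ i, g (clique i) = clique i) (v : Coord) : g v = v := by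
  apply signature_clique_injective
  have h := signature_comp hg clique v
  rwa [show g ∘ clique = clique from funext hc] at h

theorem fixes_or_swaps_clique (hg : ∀ v w, adj (g v) (g w) = adj v w)
    (hc : ∀ i, ∃ j, g (clique i) = clique j) :
    (∀ i, g (clique i) = clique i) ∨
      ∀ i, g (clique i) = clique ((![0, 3, 4, 1, 2] : Fin 5 → Fin 5) i) := by
  choose p hp using hc
  have hpi : Function.Injective p := fun i j h =>
    clique_injective (g.injective (by rw [hp, hp, h]))
  have hpe : p = ![p 0, p 1, p 2, p 3, p 4] := by
    ext i; fin_cases i <;> rfl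
  have hcount := commonNeighborCount_map hg (clique 0) (clique 1) (clique 2)
  rw [hp, hp, hp, commonNeighborCount_clique_zero_one_two] at hcount
  have hcount' := commonNeighborCount_map hg (clique 0) (clique 3) (clique 4)
  rw [hp, hp, hp, commonNeighborCount_clique_zero_three_four] at hcount'
  have hedge := noEdgeBetween_clique.comp hg
  rw [show g ∘ clique = clique ∘ p from funext hp, hpe] at hedge
  have key := eq_of_commonNeighborCount_of_noEdgeBetween (p 0) (p 1) (p 2) (p 3) (p 4)
    (hpi.ne (by decide)) (hpi.ne (by decide)) (hpi.ne (by decide)) hcount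
    (hpi.ne (by decide)) (hpi.ne (by decide)) (hpi.ne (by decide)) (hpi.ne (by decide))
    (hpi.ne (by decide)) (hpi.ne (by decide)) (hpi.ne (by decide)) hcount' hedge
  rw [← hpe] at key
  refine key.imp (fun h i => ?_) (fun h i => by rw [hp, h])
  rw [hp, h]
  fin_cases i <;> rfl

end Coord

section Embedding

variable {F : Type*} [Field F]

/-- The element of `F` with coordinates `v` in terms of the powers of `α`. -/
def Coord.eval [CharP F 3] (α : F) (v : Coord) : F :=
  ZMod.castHom dvd_rfl F v.1 + ZMod.castHom dvd_rfl F v.2.1 * α +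
    ZMod.castHom dvd_rfl F v.2.2.1 * α ^ 2 + ZMod.castHom dvd_rfl F v.2.2.2 * α ^ 3

namespace Coord

variable [CharP F 3] {α : F}

theorem eval_sub (v w : Coord) : eval α (v - w) = eval α v - eval α w := by
  simp only [eval, Prod.fst_sub, Prod.snd_sub, map_sub]
  ring

theorem eval_zero : eval α 0 = 0 := by
  simp [eval]

theorem eval_mul (hα : α ^ 4 = α ^ 2 + 1) (v w : Coord) :
    eval α (mul v w) = eval α v * eval α w := by
  obtain ⟨a, b, c, d⟩ := v
  obtain ⟨a', b', c', d'⟩ := w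
  simp only [eval, mul, map_add, map_mul, map_ofNat]
  generalize ZMod.castHom _ F a = a
  generalize ZMod.castHom _ F b = b
  generalize ZMod.castHom _ F c = c
  generalize ZMod.castHom _ F d = d
  generalize ZMod.castHom _ F a' = a'
  generalize ZMod.castHom _ F b' = b'
  generalize ZMod.castHom _ F c' = c'
  generalize ZMod.castHom _ F d' = d'
  linear_combination (-(b * d' + c * c' + d * b') - (c * d' + d * c') * α
    - d * d' * (α ^ 2 + 1)) * hα

theorem eval_cube (hα : α ^ 4 = α ^ 2 + 1) (v : Coord) : eval α (cube v) = eval α v ^ 3 := by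
  rw [cube, eval_mul hα, eval_mul hα]
  ring

theorem eval_injective (hα : α ^ 4 = α ^ 2 + 1) : Function.Injective (eval α) := by
  intro v w h
  by_contra hne
  obtain ⟨u, hu⟩ := exists_mul_eq_one (v - w) (sub_ne_zero.2 hne)
  have key := eval_mul hα (v - w) u
  rw [hu, eval_sub, h, sub_self, zero_mul] at key
  simp [eval] at key

theorem eval_bijective [Fintype F] (hF : Fintype.card F = 81) (hα : α ^ 4 = α ^ 2 + 1) :
    Function.Bijective (eval α) :=
  (Fintype.bijective_iff_injective_and_card _).2 ⟨eval_injective hα, by rw [hF]; rfl⟩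

theorem adj_iff [Fintype F] (hF : Fintype.card F = 81) (hα : α ^ 4 = α ^ 2 + 1) (v w : Coord) :
    adj v w = true ↔ eval α v ≠ eval α w ∧ IsSquare (eval α v - eval α w) := by
  have hadj : adj v w = adj (v - w) 0 := by simp [adj]
  rw [hadj, adj_zero_iff, sub_ne_zero, (eval_injective hα).ne_iff, ← eval_sub]
  refine and_congr_right fun _ => ⟨?_, ?_⟩
  · rintro ⟨u, hu⟩
    exact ⟨eval α u, by rw [← eval_mul hα, hu]⟩
  · rintro ⟨y, hy⟩
    obtain ⟨u, rfl⟩ := (eval_bijective hF hα).2 y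
    exact ⟨u, eval_injective hα (by rw [eval_mul hα, hy])⟩

end Coord

theorem IsPaleyAut.trans {f g : Equiv.Perm F} (hf : IsPaleyAut f) (hg : IsPaleyAut g) :
    IsPaleyAut (f.trans g) := fun a b => (hg _ _).trans (hf a b)

theorem charP_three_of_card_eq [Fintype F] (hF : Fintype.card F = 81) : CharP F 3 := by
  rw [CharP.charP_iff_prime_eq_zero Nat.prime_three]
  have h := Nat.cast_card_eq_zero F
  rw [hF] at h
  have h3 : (3 : F) ^ 4 = 0 := by
    norm_num
    exact_mod_cast h
  exact_mod_cast pow_eq_zero_iff (by norm_num) |>.1 h3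

/-- Of the two primitive eighth roots of unity up to conjugacy, the square condition on
`α + α²` singles out the roots of `X² - X - 1`. -/
theorem pow_four_eq_of_isSquare [Fintype F] [CharP F 3] (hF : Fintype.card F = 81) {α : F}
    (hδ : orderOf (α ^ 2) = 8) (hsq : IsSquare (α + α ^ 2)) : α ^ 4 = α ^ 2 + 1 := by
  have h3 : (3 : F) = 0 := by exact_mod_cast CharP.cast_eq_zero F 3
  have h16 : (α ^ 2) ^ 8 = 1 := hδ ▸ pow_orderOf_eq_one (α ^ 2)
  have h8 : (α ^ 2) ^ 4 ≠ 1 := fun h => by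
    have := orderOf_dvd_of_pow_eq_one h
    rw [hδ] at this
    omega
  have hneg : α ^ 8 = -1 := by
    have h : ((α ^ 2) ^ 4 - 1) * (α ^ 8 + 1) = 0 := by linear_combination h16
    rcases mul_eq_zero.1 h with h | h
    · exact absurd (sub_eq_zero.1 h) h8
    · exact eq_neg_of_add_eq_zero_left h
  have h : (α ^ 4 - α ^ 2 - 1) * (α ^ 4 + α ^ 2 - 1) = 0 := by
    linear_combination hneg - α ^ 4 * h3
  rcases mul_eq_zero.1 h with h | h
  · linear_combination h
  exfalso
  obtain ⟨y, hy⟩ := hsq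
  have hn : (α + α ^ 2) ^ 9 = -α + α ^ 2 := by
    have : (α + α ^ 2) ^ 3 ^ 2 = α ^ 3 ^ 2 + (α ^ 2) ^ 3 ^ 2 := add_pow_char_pow _ _ _ _
    norm_num at this
    rw [this]
    linear_combination (α + α ^ 10 - α ^ 2) * hneg
  have hn10 : (α + α ^ 2) ^ 10 = α ^ 2 + 1 := by
    rw [pow_succ, hn]
    linear_combination h - α ^ 2 * h3
  have hn40 : (α + α ^ 2) ^ 40 = -1 := by
    rw [show 40 = 10 * 4 from rfl, pow_mul, hn10]
    linear_combination (α ^ 4 + 3 * α ^ 2 + 4) * h + (2 + α ^ 2) * h3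
  have hy0 : y ≠ 0 := by
    rintro rfl
    rw [hy] at hn40
    simp at hn40
  have h1 : (α + α ^ 2) ^ 40 = 1 := by
    rw [hy, ← sq, ← pow_mul]
    have := FiniteField.pow_card_sub_one_eq_one y hy0
    rwa [hF] at this
  have h2 : (1 : F) = 0 := by linear_combination h1 - hn40 + h3
  exact one_ne_zero h2

namespace Coord

variable [CharP F 3] {α : F}

/-- A Paley automorphism, transported to coordinates. -/
def conj (e : Coord ≃ F) (f : Equiv.Perm F) : Equiv.Perm Coord :=
  (e.trans f).trans e.symm

theorem eval_comp_clique (hα : α ^ 4 = α ^ 2 + 1) :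
    eval α ∘ clique = ![0, 1, α ^ 2, α - α ^ 2, α ^ 2 * (α - α ^ 2)] := by
  have h3 : (3 : F) = 0 := by exact_mod_cast CharP.cast_eq_zero F 3
  have h2 : ZMod.castHom dvd_rfl F (2 : ZMod 3) = 2 := map_ofNat _ 2
  ext i
  fin_cases i <;> simp only [eval, clique, Function.comp_apply, h2, map_zero, map_one,
    Fin.zero_eta, Fin.mk_one, Fin.reduceFinMk, Matrix.cons_val]
  · ring
  · ring
  · ring
  · linear_combination α ^ 2 * h3
  · linear_combination hα + (1 + α ^ 2) * h3

variable [Fintype F]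

theorem isPaleyClique_range_clique (hF : Fintype.card F = 81) (hα : α ^ 4 = α ^ 2 + 1) :
    IsPaleyClique (Set.range (eval α ∘ clique)) := by
  rintro _ ⟨i, rfl⟩ _ ⟨j, rfl⟩ hne
  exact ((adj_iff hF hα _ _).1 (adj_clique i j fun h => hne (by rw [h]))).2

theorem isMaximalPaleyClique_range_clique (hF : Fintype.card F = 81) (hα : α ^ 4 = α ^ 2 + 1) :
    IsMaximalPaleyClique (Set.range (eval α ∘ clique)) := by
  refine ⟨isPaleyClique_range_clique hF hα, fun D hD hCD => hCD.antisymm' fun x hx => ?_⟩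
  by_contra hxC
  obtain ⟨v, rfl⟩ := (eval_bijective hF hα).2 x
  obtain ⟨i, hi⟩ := exists_not_adj_clique v
  have hi' := hCD ⟨i, rfl⟩
  have hne : eval α (clique i) ≠ eval α v := fun h => hxC ⟨i, h⟩
  rw [(adj_iff hF hα _ _).2 ⟨hne, hD _ hi' _ hx hne⟩] at hi
  exact absurd hi (by simp)

theorem conj_adj (hF : Fintype.card F = 81) (hα : α ^ 4 = α ^ 2 + 1) {f : Equiv.Perm F}
    (hf : IsPaleyAut f) (v w : Coord) :
    adj (conj (.ofBijective _ (eval_bijective hF hα)) f v)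
      (conj (.ofBijective _ (eval_bijective hF hα)) f w) = adj v w := by
  rw [Bool.eq_iff_iff, adj_iff hF hα, adj_iff hF hα, ← hf (eval α v)]
  have h (u) : eval α (conj (.ofBijective _ (eval_bijective hF hα)) f u) = f (eval α u) :=
    (Equiv.ofBijective _ (eval_bijective hF hα)).apply_symm_apply _
  rw [h, h]

theorem conj_eq_iff (hF : Fintype.card F = 81) (hα : α ^ 4 = α ^ 2 + 1) {f : Equiv.Perm F}
    (v w : Coord) :
    conj (.ofBijective _ (eval_bijective hF hα)) f v = w ↔ f (eval α v) = eval α w :=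
  (Equiv.ofBijective _ (eval_bijective hF hα)).symm_apply_eq

theorem eq_refl_of_fixes_range_clique (hF : Fintype.card F = 81) (hα : α ^ 4 = α ^ 2 + 1)
    {f : Equiv.Perm F} (hf : IsPaleyAut f)
    (hc : ∀ i, f (eval α (clique i)) = eval α (clique i)) (x : F) : f x = x := by
  obtain ⟨v, rfl⟩ := (eval_bijective hF hα).2 x
  rw [← conj_eq_iff hF hα]
  exact eq_one_of_fixes_clique (conj_adj hF hα hf)
    (fun i => (conj_eq_iff hF hα _ _).2 (hc i)) v

theorem fixes_or_swaps_of_mem_paleyStab (hF : Fintype.card F = 81) (hα : α ^ 4 = α ^ 2 + 1)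
    {f : Equiv.Perm F} (hf : f ∈ paleyStab (Set.range (eval α ∘ clique))) :
    (∀ i, f (eval α (clique i)) = eval α (clique i)) ∨
      ∀ i, f (eval α (clique i)) = eval α (clique ((![0, 3, 4, 1, 2] : Fin 5 → Fin 5) i)) := by
  simp only [← conj_eq_iff hF hα]
  refine fixes_or_swaps_clique (conj_adj hF hα hf.1) fun i => ?_
  obtain ⟨j, hj⟩ : f (eval α (clique i)) ∈ Set.range (eval α ∘ clique) :=
    hf.2 ▸ Set.mem_image_of_mem _ ⟨i, rfl⟩
  exact ⟨j, (conj_eq_iff hF hα _ _).2 hj.symm⟩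

end Coord

section Semilinear

variable [Fintype F] {s : F}

theorem involutive_mul_pow_nine (hF : Fintype.card F = 81) (hs : s ^ 10 = 1) :
    Function.Involutive fun x : F => s * x ^ 9 := by
  intro x
  have hx : x ^ 81 = x := hF ▸ FiniteField.pow_card x
  linear_combination x ^ 81 * hs + hx

theorem isPaleyAut_mul_pow_nine [CharP F 3] (hF : Fintype.card F = 81) (hs : s ^ 10 = 1)
    (hsq : IsSquare s) : IsPaleyAut (involutive_mul_pow_nine hF hs).toPerm := by
  have hsub (a b : F) : s * a ^ 9 - s * b ^ 9 = s * (a - b) ^ 9 := by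
    have h : (a - b) ^ 3 ^ 2 = a ^ 3 ^ 2 - b ^ 3 ^ 2 := sub_pow_char_pow _ _ _
    norm_num at h
    rw [h, mul_sub]
  intro a b
  rw [(Equiv.injective _).ne_iff]
  refine and_congr_right fun _ => ?_
  simp only [Function.Involutive.coe_toPerm]
  rw [hsub]
  refine ⟨fun h => ?_, fun h => hsq.mul (h.pow 9)⟩
  rw [← involutive_mul_pow_nine hF hs (a - b)]
  exact hsq.mul (h.pow 9)

end Semilinear

/-- The semilinear map `x ↦ (α - α²) x⁹` swaps `1` with `α - α²` and `α²` with `α² (α - α²)`. -/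
theorem Coord.mul_pow_nine_eval_clique [CharP F 3] {α : F} (hα : α ^ 4 = α ^ 2 + 1) (i : Fin 5) :
    (α - α ^ 2) * eval α (clique i) ^ 9 =
      eval α (clique ((![0, 3, 4, 1, 2] : Fin 5 → Fin 5) i)) := by
  have hs : eval α (clique 3) = α - α ^ 2 := congrFun (eval_comp_clique hα) 3
  rw [← mul_cube_cube_clique, eval_mul hα, eval_cube hα, eval_cube hα, hs, ← pow_mul]

end Embedding

theorem stabilizer_C9 (F : Type*) [Field F] [Fintype F] (hF : Fintype.card F = 81)
    (δ α : F) (hδ : orderOf δ = 8) (hα : α ^ 2 = δ)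
    (hS : {y : F | IsSquare y ∧ ∃ x : F, x ^ 9 = x ∧ y = x + α}
        = {α + δ, α + δ ^ 2, α + δ ^ 5, α + δ ^ 6}) :
    IsMaximalPaleyClique ({0, 1, δ, α + δ ^ 5, δ * (α + δ ^ 5)} : Set F) ∧
    ({0, 1, δ, α + δ ^ 5, δ * (α + δ ^ 5)} : Set F).ncard = 5 ∧
    paleyStab ({0, 1, δ, α + δ ^ 5, δ * (α + δ ^ 5)} : Set F)
      = {f : Equiv.Perm F |
          (∀ γ : F, f γ = γ) ∨ (∀ γ : F, f γ = (α + δ ^ 5) * γ ^ 9)} ∧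
    (paleyStab ({0, 1, δ, α + δ ^ 5, δ * (α + δ ^ 5)} : Set F)).ncard = 2 := by
  subst hα
  have := charP_three_of_card_eq hF
  have hsq : α + α ^ 2 ∈ {y : F | IsSquare y ∧ ∃ x : F, x ^ 9 = x ∧ y = x + α} := by
    rw [hS]; simp
  have hα := pow_four_eq_of_isSquare hF hδ hsq.1
  have h3 : (3 : F) = 0 := by exact_mod_cast CharP.cast_eq_zero F 3
  have h8 : α ^ 8 = -1 := by linear_combination (α ^ 4 + α ^ 2 + 2) * hα + (α ^ 2 + 1) * h3
  have hs : α + (α ^ 2) ^ 5 = α - α ^ 2 := by linear_combination α ^ 2 * h8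
  rw [hs]
  have hC : ({0, 1, α ^ 2, α - α ^ 2, α ^ 2 * (α - α ^ 2)} : Set F) =
      Set.range (Coord.eval α ∘ Coord.clique) := by
    rw [Coord.eval_comp_clique hα]
    simp only [Matrix.range_cons, Matrix.range_empty, Set.union_empty, Set.singleton_union]
  rw [hC]
  have hinj : Function.Injective (Coord.eval α ∘ Coord.clique) :=
    (Coord.eval_injective hα).comp Coord.clique_injective
  have hsq' : IsSquare (α - α ^ 2) := by
    have := hS.symm.le (show α + (α ^ 2) ^ 5 ∈ _ by simp)
    exact hs ▸ this.1
  have hs10 : (α - α ^ 2) ^ 10 = 1 := by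
    have := Coord.mul_pow_nine_eval_clique hα 3
    have h1 := congrFun (Coord.eval_comp_clique hα) 1
    have h3 := congrFun (Coord.eval_comp_clique hα) 3
    simp at this h1 h3
    rw [h1, h3] at this
    linear_combination this
  set σ : Equiv.Perm F := (involutive_mul_pow_nine hF hs10).toPerm with hσ
  have hσ_apply (x : F) : σ x = (α - α ^ 2) * x ^ 9 := rfl
  have hσ_aut : IsPaleyAut σ := isPaleyAut_mul_pow_nine hF hs10 hsq'
  have hσ_clique (i) := Coord.mul_pow_nine_eval_clique hα i
  have hstab : paleyStab (Set.range (Coord.eval α ∘ Coord.clique)) =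
      {f : Equiv.Perm F | (∀ γ, f γ = γ) ∨ ∀ γ, f γ = (α - α ^ 2) * γ ^ 9} := by
    ext f
    constructor
    · intro hf
      refine (Coord.fixes_or_swaps_of_mem_paleyStab hF hα hf).imp
        (Coord.eq_refl_of_fixes_range_clique hF hα hf.1) fun h x => ?_
      have key := Coord.eq_refl_of_fixes_range_clique hF hα (hf.1.trans hσ_aut) (fun i => by
        rw [Equiv.trans_apply, h, hσ_apply, hσ_clique]
        fin_cases i <;> rfl) x
      rw [← hσ_apply]
      rw [Equiv.trans_apply] at key
      conv_rhs => rw [← key]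
      exact (involutive_mul_pow_nine hF hs10 _).symm
    · rintro (h | h)
      · obtain rfl : f = 1 := Equiv.ext h
        exact ⟨fun _ _ => Iff.rfl, Set.image_id _⟩
      · obtain rfl : f = σ := Equiv.ext h
        refine ⟨hσ_aut, ?_⟩
        have hp : Function.Surjective (![0, 3, 4, 1, 2] : Fin 5 → Fin 5) := by decide
        rw [← Set.range_comp, ← hp.range_comp (Coord.eval α ∘ Coord.clique)]
        exact congrArg Set.range (funext hσ_clique)
  refine ⟨Coord.isMaximalPaleyClique_range_clique hF hα, ?_, hstab, ?_⟩
  · rw [Set.ncard_range_of_injective hinj]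
    simp
  · have hpair : {f : Equiv.Perm F | (∀ γ, f γ = γ) ∨ ∀ γ, f γ = (α - α ^ 2) * γ ^ 9} =
        {1, σ} := by
      ext f
      simp only [Set.mem_ofPred_eq, Set.mem_insert_iff, Set.mem_singleton_iff, Equiv.ext_iff,
        Equiv.Perm.one_apply, hσ_apply]
    rw [hstab, hpair, Set.ncard_pair]
    intro h
    have h1 := hσ_clique 1
    rw [← hσ_apply, ← h] at h1
    exact absurd (hinj h1) (by decide)
end

section
/- Let F be the finite field of order 81, let δ ∈ F have multiplicative order 8, and let α ∈ F satisfy α² = δ, chosen so that the squares of F among {x + α : x ∈ F_9} are exactly {α+δ, α+δ², α+δ⁵, α+δ⁶}. Set C_9 := {0, 1, δ, α+δ⁵, δ·(α+δ⁵)}. Then the orbit of C_9 under the natural action of the automorphism group of P(81) on vertex subsets equals the collection of all sets {s·x^η + γ : x ∈ C_9}, where s ranges over the nonzero squares of F, γ ranges over F, and η ∈ {1, 3}; moreover this orbit has cardinality 6480. -/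
/-! ### Codes for the elements of the field of order 81

Over a root `α` of `X ^ 4 - X ^ 2 - 1`, an element `a + b α + c α ^ 2 + d α ^ 3` is encoded by the
natural number with base-3 digits `a, b, c, d`. -/

namespace Paley81

/-- The code of `a + b α + c α ^ 2 + d α ^ 3`. -/
def code (a b c d : ℕ) : ℕ := a % 3 + 3 * (b % 3) + 9 * (c % 3) + 27 * (d % 3)

/-- Addition on codes. -/
def addCode (m n : ℕ) : ℕ :=
  code (m + n) (m / 3 + n / 3) (m / 9 + n / 9) (m / 27 + n / 27)

/-- Subtraction on codes. -/
def subCode (m n : ℕ) : ℕ :=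
  code (m + 2 * n) (m / 3 + 2 * (n / 3)) (m / 9 + 2 * (n / 9)) (m / 27 + 2 * (n / 27))

/-- Multiplication of polynomials in `α`, reduced by `α ^ 4 = α ^ 2 + 1`. -/
def mulDigits (a b c d p q r s : ℕ) : ℕ :=
  code (a * p + (b * s + c * r + d * q) + d * s)
    (a * q + b * p + (c * s + d * r))
    (a * r + b * q + c * p + (b * s + c * r + d * q) + 2 * (d * s))
    (a * s + b * r + c * q + d * p + (c * s + d * r))

/-- Multiplication on codes. -/
def mulCode (m n : ℕ) : ℕ :=
  mulDigits (m % 3) (m / 3 % 3) (m / 9 % 3) (m / 27 % 3)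
    (n % 3) (n / 3 % 3) (n / 9 % 3) (n / 27 % 3)

/-- The `i`-th binary digit of `m`. -/
def bit (m i : ℕ) : Bool := Nat.beq (Nat.mod (Nat.shiftRight m i) 2) 1

/-- The set of codes of squares, as a bit mask. -/
def sqMask : ℕ := 673074136270519970676231

/-- The reflexive Paley relation on codes, as an 81 by 81 bit matrix. -/
def sqMatrix : ℕ :=
  1001753477570097924855267234058501434436347125510602036424371859285585682088509909885130067767228761154436880177993332065144839098589719417850052096461627393849664041322269807786937257195791845267133958061262970433616248739118117345393524520723730798655768569099263017709245520986227363174854172613967141276397879605789406137095405959742338972122646648420582996520562460575940579664463389541029445248775447282807916631219400580036333765912737814512210128221510536557451084052692504220212167731018740430502701082008867933477724488385593414607241802607547934204516301866756693945722365242796198562335986427927615560068849023376101244035674228532122241495293043870067479769867969277505654271787768090123009348339887029537138867921702440358840527997831501444703467660031321999156605754949019673112387371554130099686853629054368086617772566322647641433371462183078179675281454214193173293603656210935898297015702336321347170317469622200370468478633202421762163527645479543215698186682929587425393620181825367239482667194136083041749928355544652303163155163854442539971636906510853407350198580542552033119525968993961407023663465925634481671837607895977864103745438317304841823972111939749988890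9883337764382072724269851898627636600545212669542320264566008513841580694029466187288538550155729945188860238759553604047148092202041765922289173821943000066725106459881268289182416207168543047447675743102162874456955553778149723849257241927217553006237382422205638072759543604397759752079108255540708827118070808921623364720906647513255375622050605304314191031791253462535033023775300275639866471008338130461045971351523805373474213577348379560558986946106928932911262647221305886262909156318336447954366640403798203624130291155738644742273898175981067522867822255743572642981090486680595312589580473118231273530131068003114614072205236006393273486215754171756364488952504851950679170824248509134112384672771617080320380044211220951868996911906443857422991435817020098827488032683048455

/-- The reflexive Paley relation on codes. -/
def adj (u v : ℕ) : Bool := bit sqMatrix (Nat.add (Nat.mul 81 u) v)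

/-- The neighbours of `u`, as a bit mask. -/
def row (u : ℕ) : ℕ := Nat.mod (Nat.shiftRight sqMatrix (Nat.mul 81 u)) (2 ^ 81)

/-! ### A backtracking search for relation-preserving maps -/

/-- `force n k = k n`, arranged so that the kernel evaluates `n` before passing it to `k`. -/
def force (n : ℕ) (k : ℕ → Bool) : Bool := Nat.rec (k 0) (fun p _ => k (Nat.succ p)) n

/-- The mask of possible images of `v` under a map with the values listed. -/
def candidates : List (ℕ × ℕ) → ℕ → ℕ
  | [], _ => 2417851639229258349412351
  | (u, w) :: as, v => Nat.land
    (bif adj u v then row w else Nat.xor (row w) 2417851639229258349412351) (candidates as v)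

/-- Whether the mask `m` has at most `k` members, all of which satisfy `p`. -/
def allBits (p : ℕ → Bool) : ℕ → ℕ → Bool
  | 0, m => Nat.beq m 0
  | k + 1, m => bif Nat.beq m 0 then true else
    force (Nat.log2 m) fun w =>
      bif p w then force (Nat.sub m (Nat.pow 2 w)) (allBits p k) else false

/-- Whether a search branching on the images of `vs` finds that no relation-preserving map has
the values listed. -/
def refute : List ℕ → List (ℕ × ℕ) → Bool
  | [], _ => false
  | v :: vs, as => force (candidates as v) (allBits (fun w => refute vs ((v, w) :: as)) 81)

/-- Whether a search finds that the image of `v` under any relation-preserving map with the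
values listed satisfies `ok`. -/
def confined (ok : ℕ → Bool) (v : ℕ) (vs : List ℕ) (as : List (ℕ × ℕ)) : Bool :=
  force (candidates as v) (allBits (fun w => bif ok w then true else refute vs ((v, w) :: as)) 81)

/-- Whether a search finds that every relation-preserving map with the values listed fixes all
of `vs`. -/
def rigid : List ℕ → List (ℕ × ℕ) → Bool
  | [], _ => true
  | v :: vs, as => bif confined (Nat.beq v) v vs as then rigid vs ((v, v) :: as) else false

/-- The codes other than those of `0`, `1` and `α`. -/
def searchOrder : List ℕ := 2 :: List.range' 4 77

set_option maxHeartbeats 0 in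
theorem confined_generator :
    confined (fun w => [3, 6, 27, 54].contains w) 3 searchOrder [(1, 1), (0, 0)] = true := by
  decide +kernel

set_option maxHeartbeats 0 in
theorem rigid_searchOrder : rigid searchOrder [(3, 3), (1, 1), (0, 0)] = true := by
  decide +kernel

theorem force_eq (n : ℕ) (k : ℕ → Bool) : force n k = k n := by
  cases n <;> rfl

theorem bit_eq_testBit (m i : ℕ) : bit m i = m.testBit i := by
  have h : Nat.mod (Nat.shiftRight m i) 2 = m / 2 ^ i % 2 := by
    change (m >>> i) % 2 = _
    rw [Nat.shiftRight_eq_div_pow]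
  rw [Nat.testBit_eq_decide_div_mod_eq, bit, h, Bool.eq_iff_iff, Nat.beq_eq, decide_eq_true_iff]

theorem bit_row (u : ℕ) {v : ℕ} (hv : v < 81) : bit (row u) v = adj u v := by
  simp only [adj, bit_eq_testBit]
  change ((sqMatrix >>> (81 * u)) % 2 ^ 81).testBit v = sqMatrix.testBit (81 * u + v)
  rw [Nat.testBit_mod_two_pow, Nat.testBit_shiftRight, decide_eq_true hv, Bool.true_and]

theorem testBit_sub_two_pow_log2 {m i : ℕ} (hm : m ≠ 0) (hi : i ≠ m.log2)
    (h : m.testBit i = true) : (m - 2 ^ m.log2).testBit i = true := by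
  have h1 : 2 ^ m.log2 ≤ m := Nat.log2_self_le hm
  have h2 : m < 2 ^ (m.log2 + 1) := Nat.lt_log2_self
  have hr : m - 2 ^ m.log2 < 2 ^ m.log2 := by rw [pow_succ] at h2; omega
  rcases lt_or_gt_of_ne hi with hlt | hgt
  · have e : m = 2 ^ m.log2 * 1 + (m - 2 ^ m.log2) := by omega
    rw [e, Nat.testBit_two_pow_mul_add 1 hr, if_pos hlt] at h
    exact h
  · rw [Nat.testBit_lt_two_pow (lt_of_lt_of_le h2 (Nat.pow_le_pow_right two_pos hgt))] at h
    exact absurd h (by simp)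

theorem of_allBits {p : ℕ → Bool} {w : ℕ} :
    ∀ {k m : ℕ}, allBits p k m = true → bit m w = true → p w = true
  | 0, m, h, hw => by
    have : m = 0 := Nat.eq_of_beq_eq_true h
    simp [this, bit_eq_testBit] at hw
  | k + 1, m, h, hw => by
    by_cases hm : m = 0
    · simp [hm, bit_eq_testBit] at hw
    · have hb : Nat.beq m 0 = false := by
        rw [← Bool.not_eq_true]; exact fun hh => hm (Nat.eq_of_beq_eq_true hh)
      rw [allBits, hb, cond_false, force_eq] at h
      cases hp : p m.log2 with
      | false => simp [hp] at h
      | true =>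
        rw [hp, cond_true, force_eq] at h
        by_cases hi : w = m.log2
        · rw [hi, hp]
        · refine of_allBits h ?_
          rw [bit_eq_testBit] at hw ⊢
          exact testBit_sub_two_pow_log2 hm hi hw

section Search

variable {f : ℕ → ℕ} (hf : ∀ u < 81, f u < 81)
  (hadj : ∀ u < 81, ∀ v < 81, adj (f u) (f v) = adj u v)

include hf hadj

theorem bit_candidates {v : ℕ} (hv : v < 81) :
    ∀ {as : List (ℕ × ℕ)}, (∀ p ∈ as, p.1 < 81 ∧ f p.1 = p.2) →
      bit (candidates as v) (f v) = true
  | [], _ => by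
    have h : candidates [] v = 2 ^ 81 - 1 := rfl
    rw [bit_eq_testBit, h, Nat.testBit_two_pow_sub_one]
    simpa using hf v hv
  | (u, w) :: as, h => by
    obtain ⟨hu, hw⟩ := h (u, w) (by simp)
    simp only at hu hw
    have ih := bit_candidates hv (as := as) fun p hp => h p (by simp [hp])
    have hr : bit (row w) (f v) = adj u v := by
      rw [bit_row w (hf v hv), ← hw, hadj u hu v hv]
    rw [bit_eq_testBit] at ih hr ⊢
    change ((bif adj u v then row w else row w ^^^ (2 ^ 81 - 1)) &&& candidates as v).testBit _ = _
    rw [Nat.testBit_and, ih, Bool.and_true]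
    cases ha : adj u v with
    | true => rw [cond_true, hr, ha]
    | false =>
      rw [cond_false, Nat.testBit_xor, hr, ha, Nat.testBit_two_pow_sub_one]
      simpa using hf v hv

theorem not_refute : ∀ {vs : List ℕ} {as : List (ℕ × ℕ)}, (∀ v ∈ vs, v < 81) →
    (∀ p ∈ as, p.1 < 81 ∧ f p.1 = p.2) → refute vs as = true → False
  | [], _, _, _, h => by simp [refute] at h
  | v :: vs, as, hvs, has, h => by
    have hv : v < 81 := hvs v (by simp)
    rw [refute, force_eq] at h
    refine not_refute (vs := vs) (as := (v, f v) :: as) (fun u hu => hvs u (by simp [hu])) ?_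
      (of_allBits h (bit_candidates hf hadj hv has))
    rintro p hp
    rcases List.mem_cons.1 hp with rfl | hp
    · exact ⟨hv, rfl⟩
    · exact has p hp

theorem of_confined {ok : ℕ → Bool} {v : ℕ} {vs : List ℕ} {as : List (ℕ × ℕ)} (hv : v < 81)
    (hvs : ∀ v ∈ vs, v < 81) (has : ∀ p ∈ as, p.1 < 81 ∧ f p.1 = p.2)
    (h : confined ok v vs as = true) : ok (f v) = true := by
  rw [confined, force_eq] at h
  have h' := of_allBits h (bit_candidates hf hadj hv has)
  cases hok : ok (f v) with
  | true => rfl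
  | false =>
    rw [hok, cond_false] at h'
    refine (not_refute hf hadj hvs ?_ h').elim
    rintro p hp
    rcases List.mem_cons.1 hp with rfl | hp
    · exact ⟨hv, rfl⟩
    · exact has p hp

theorem eq_of_rigid : ∀ {vs : List ℕ} {as : List (ℕ × ℕ)}, (∀ v ∈ vs, v < 81) →
    (∀ p ∈ as, p.1 < 81 ∧ f p.1 = p.2) → rigid vs as = true → ∀ v ∈ vs, f v = v
  | [], _, _, _, _ => by simp
  | v :: vs, as, hvs, has, h => by
    have hv : v < 81 := hvs v (by simp)
    have hvs' : ∀ u ∈ vs, u < 81 := fun u hu => hvs u (by simp [hu])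
    cases hc : confined (Nat.beq v) v vs as with
    | false => simp [rigid, hc] at h
    | true =>
      rw [rigid, hc, cond_true] at h
      have hfv : f v = v := (Nat.eq_of_beq_eq_true (of_confined hf hadj hv hvs' has hc)).symm
      have ih := eq_of_rigid (vs := vs) (as := (v, v) :: as) hvs' (by
        rintro p hp
        rcases List.mem_cons.1 hp with rfl | hp
        · exact ⟨hv, hfv⟩
        · exact has p hp) h
      rintro u hu
      rcases List.mem_cons.1 hu with rfl | hu
      · exact hfv
      · exact ih u hu

theorem map_three_mem (h0 : f 0 = 0) (h1 : f 1 = 1) : f 3 ∈ [3, 6, 27, 54] := by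
  have h := of_confined hf hadj (by norm_num) (by decide) (by simp [h0, h1]) confined_generator
  simpa using h

theorem eq_self_of_fixed (h0 : f 0 = 0) (h1 : f 1 = 1) (h3 : f 3 = 3) : ∀ v < 81, f v = v := by
  intro v hv
  have h := eq_of_rigid hf hadj (by decide) (by simp [h0, h1, h3]) rigid_searchOrder
  by_cases hm : v ∈ searchOrder
  · exact h v hm
  · have : v = 0 ∨ v = 1 ∨ v = 3 := by
      simp only [searchOrder, List.mem_cons, List.mem_range'_1, not_or, not_and] at hm
      omega
    rcases this with rfl | rfl | rfl <;> assumption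

end Search

theorem exists_mulCode_eq_one : ∀ n < 81, n ≠ 0 → ∃ j < 81, mulCode j n = 1 := by
  decide +kernel

theorem bit_mulCode_self : ∀ j < 81, bit sqMask (mulCode j j) = true := by
  decide +kernel

theorem exists_mulCode_self_eq : ∀ n < 81, bit sqMask n = true → ∃ j < 81, mulCode j j = n := by
  decide +kernel

theorem adj_eq_bit : ∀ u < 81, ∀ v < 81, adj u v = bit sqMask (subCode u v) := by
  decide +kernel

theorem eq_of_subCode_eq_zero : ∀ m < 81, ∀ n < 81, subCode m n = 0 → m = n := by
  decide +kernel

theorem code_lt (a b c d : ℕ) : code a b c d < 81 := by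
  unfold code; omega

/-! ### Decoding -/

section Decode

variable {F : Type*} [Field F]

/-- The field element with a given code. -/
def ofCode (α : F) (n : ℕ) : F :=
  (n % 3 : ℕ) + (n / 3 % 3 : ℕ) * α + (n / 9 % 3 : ℕ) * α ^ 2 + (n / 27 % 3 : ℕ) * α ^ 3

variable {α : F} (h3 : (3 : F) = 0)

include h3

theorem cast_mod_three (n : ℕ) : ((n % 3 : ℕ) : F) = n := by
  conv_rhs => rw [← Nat.mod_add_div n 3]
  push_cast
  rw [h3, zero_mul, add_zero]

theorem ofCode_code (a b c d : ℕ) :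
    ofCode α (code a b c d) = a + b * α + c * α ^ 2 + d * α ^ 3 := by
  have e0 : code a b c d % 3 = a % 3 := by unfold code; omega
  have e1 : code a b c d / 3 % 3 = b % 3 := by unfold code; omega
  have e2 : code a b c d / 9 % 3 = c % 3 := by unfold code; omega
  have e3 : code a b c d / 27 % 3 = d % 3 := by unfold code; omega
  rw [ofCode, e0, e1, e2, e3]
  simp only [cast_mod_three h3]

theorem ofCode_eq (n : ℕ) : ofCode α n =
    n + (n / 3 : ℕ) * α + (n / 9 : ℕ) * α ^ 2 + (n / 27 : ℕ) * α ^ 3 := by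
  simp only [ofCode, cast_mod_three h3]

theorem ofCode_addCode (m n : ℕ) : ofCode α (addCode m n) = ofCode α m + ofCode α n := by
  rw [addCode, ofCode_code h3, ofCode_eq h3, ofCode_eq h3]
  push_cast
  ring

theorem ofCode_subCode (m n : ℕ) : ofCode α (subCode m n) = ofCode α m - ofCode α n := by
  rw [subCode, ofCode_code h3, ofCode_eq h3, ofCode_eq h3]
  generalize n / 3 = b, n / 9 = c, n / 27 = d
  push_cast
  linear_combination (n + b * α + c * α ^ 2 + d * α ^ 3 : F) * h3

omit h3 in
theorem ofCode_three : ofCode α 3 = α := by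
  simp [ofCode]

variable (hα : α ^ 4 = α ^ 2 + 1)

include hα

theorem ofCode_mulCode (m n : ℕ) : ofCode α (mulCode m n) = ofCode α m * ofCode α n := by
  rw [mulCode, mulDigits, ofCode_code h3, ofCode, ofCode]
  generalize m % 3 = a, m / 3 % 3 = b, m / 9 % 3 = c, m / 27 % 3 = d,
    n % 3 = a', n / 3 % 3 = b', n / 9 % 3 = c', n / 27 % 3 = d'
  push_cast
  linear_combination (-((b * d' + c * c' + d * b' : F) + (c * d' + d * c') * α
    + d * d' * (α ^ 2 + 1))) * hα

theorem ofCode_ne_zero {n : ℕ} (hn : n < 81) (h0 : n ≠ 0) : ofCode α n ≠ 0 := by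
  obtain ⟨j, -, hj⟩ := exists_mulCode_eq_one n hn h0
  intro h
  have := ofCode_mulCode h3 hα j n
  rw [hj, h, mul_zero] at this
  simp [ofCode] at this

theorem ofCode_injOn {m n : ℕ} (hm : m < 81) (hn : n < 81) (h : ofCode α m = ofCode α n) :
    m = n := by
  by_contra hne
  refine ofCode_ne_zero h3 hα (n := subCode m n) (code_lt ..) ?_ ?_
  · exact fun h' => hne (eq_of_subCode_eq_zero m hm n hn h')
  · rw [ofCode_subCode h3, h, sub_self]

variable [Fintype F] (hF : Fintype.card F = 81)

include hF

theorem exists_ofCode (x : F) : ∃ n < 81, ofCode α n = x := by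
  have hinj : Function.Injective fun n : Fin 81 => ofCode α n := fun m n h =>
    Fin.ext (ofCode_injOn h3 hα m.2 n.2 h)
  obtain ⟨n, hn⟩ := ((Fintype.bijective_iff_injective_and_card _).2 ⟨hinj, by simp [hF]⟩).2 x
  exact ⟨n, n.2, hn⟩

theorem isSquare_ofCode {n : ℕ} (hn : n < 81) : IsSquare (ofCode α n) ↔ bit sqMask n = true := by
  constructor
  · rintro ⟨y, hy⟩
    obtain ⟨j, hj, rfl⟩ := exists_ofCode h3 hα hF y
    rw [← ofCode_mulCode h3 hα] at hy
    rw [ofCode_injOn h3 hα hn (code_lt ..) hy]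
    exact bit_mulCode_self j hj
  · intro h
    obtain ⟨j, -, rfl⟩ := exists_mulCode_self_eq n hn h
    exact ⟨ofCode α j, ofCode_mulCode h3 hα j j⟩

theorem isSquare_ofCode_sub {u v : ℕ} (hu : u < 81) (hv : v < 81) :
    IsSquare (ofCode α u - ofCode α v) ↔ adj u v = true := by
  rw [← ofCode_subCode h3, isSquare_ofCode h3 hα hF (n := subCode u v) (code_lt ..), adj_eq_bit u hu v hv]

/-- A map on codes induced by a map of the field. -/
theorem exists_map_codes {g : F → F} (hg : ∀ x y, IsSquare (g x - g y) ↔ IsSquare (x - y)) :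
    ∃ f : ℕ → ℕ, (∀ u < 81, f u < 81) ∧ (∀ u < 81, ∀ v < 81, adj (f u) (f v) = adj u v) ∧
      ∀ u, ofCode α (f u) = g (ofCode α u) := by
  choose f hf hfg using fun u => exists_ofCode h3 hα hF (g (ofCode α u))
  refine ⟨f, fun u _ => hf u, fun u hu v hv => ?_, hfg⟩
  rw [Bool.eq_iff_iff, ← isSquare_ofCode_sub h3 hα hF (hf u) (hf v), hfg, hfg, hg,
    isSquare_ofCode_sub h3 hα hF hu hv]

theorem map_generator {g : F → F} (hg : ∀ x y, IsSquare (g x - g y) ↔ IsSquare (x - y))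
    (h0 : g 0 = 0) (h1 : g 1 = 1) : ∃ i ≤ 3, g α = α ^ 3 ^ i := by
  obtain ⟨f, hf, hadj, hfg⟩ := exists_map_codes h3 hα hF hg
  have hf0 : f 0 = 0 := ofCode_injOn h3 hα (hf 0 (by norm_num)) (by norm_num) (by
    rw [hfg]; simpa [ofCode] using h0)
  have hf1 : f 1 = 1 := ofCode_injOn h3 hα (hf 1 (by norm_num)) (by norm_num) (by
    rw [hfg]; simpa [ofCode] using h1)
  have hmem := map_three_mem hf hadj hf0 hf1
  have hgα := hfg 3
  rw [ofCode_three] at hgα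
  rw [← hgα]
  have h9 : α ^ 9 = -α := by
    linear_combination (α ^ 5 + α ^ 3 + 2 * α) * hα + (α ^ 3 + α) * h3
  simp only [List.mem_cons, List.not_mem_nil, or_false] at hmem
  rcases hmem with h | h | h | h <;> rw [h]
  · exact ⟨0, by norm_num, by simp [ofCode]⟩
  · refine ⟨2, by norm_num, ?_⟩
    norm_num [ofCode, h9]
    linear_combination α * h3
  · exact ⟨1, by norm_num, by norm_num [ofCode]⟩
  · refine ⟨3, by norm_num, ?_⟩
    rw [show (3 : ℕ) ^ 3 = 9 * 3 by norm_num, pow_mul, h9]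
    norm_num [ofCode]
    linear_combination α ^ 3 * h3

theorem eq_self_of_fixed_generator {g : F → F}
    (hg : ∀ x y, IsSquare (g x - g y) ↔ IsSquare (x - y))
    (h0 : g 0 = 0) (h1 : g 1 = 1) (hgα : g α = α) (x : F) : g x = x := by
  obtain ⟨f, hf, hadj, hfg⟩ := exists_map_codes h3 hα hF hg
  have hf0 : f 0 = 0 := ofCode_injOn h3 hα (hf 0 (by norm_num)) (by norm_num) (by
    rw [hfg]; simpa [ofCode] using h0)
  have hf1 : f 1 = 1 := ofCode_injOn h3 hα (hf 1 (by norm_num)) (by norm_num) (by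
    rw [hfg]; simpa [ofCode] using h1)
  have hf3 : f 3 = 3 := ofCode_injOn h3 hα (hf 3 (by norm_num)) (by norm_num) (by
    rw [hfg, ofCode_three, hgα])
  obtain ⟨n, hn, rfl⟩ := exists_ofCode h3 hα hF x
  rw [← hfg, eq_self_of_fixed hf hadj hf0 hf1 hf3 n hn]

end Decode

/-! ### The automorphisms of the Paley graph -/

section Automorphisms

variable {F : Type*} [Field F]

theorem isSquare_mul_iff {s x : F} (hs : IsSquare s) (h0 : s ≠ 0) :
    IsSquare (s * x) ↔ IsSquare x := by
  refine ⟨fun h => ?_, hs.mul⟩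
  have := (hs.inv).mul h
  rwa [inv_mul_cancel_left₀ h0] at this

theorem isSquare_pow_three_iff {x : F} : IsSquare (x ^ 3) ↔ IsSquare x := by
  by_cases hx : x = 0
  · simp [hx]
  · rw [pow_succ, isSquare_mul_iff ⟨x, sq x⟩ (pow_ne_zero 2 hx)]

theorem isPaleyAut_iff {f : Equiv.Perm F} :
    IsPaleyAut f ↔ ∀ x y, IsSquare (f x - f y) ↔ IsSquare (x - y) := by
  refine forall₂_congr fun x y => ?_
  by_cases h : x = y
  · simp [h]
  · simp [h]

variable (h3 : (3 : F) = 0)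

include h3

theorem isSquare_frobenius_sub (i : ℕ) (x y : F) :
    IsSquare (x ^ 3 ^ i - y ^ 3 ^ i) ↔ IsSquare (x - y) := by
  induction i with
  | zero => simp
  | succ i ih =>
    rw [pow_succ, pow_mul, pow_mul, ← ih, ← isSquare_pow_three_iff (x := x ^ 3 ^ i - y ^ 3 ^ i)]
    generalize x ^ 3 ^ i = a, y ^ 3 ^ i = b
    rw [show a ^ 3 - b ^ 3 = (a - b) ^ 3 by linear_combination (a ^ 2 * b - a * b ^ 2) * h3]

variable [Fintype F] (hF : Fintype.card F = 81)

include hF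

omit h3 in
theorem pow_eighty_one (x : F) : x ^ 81 = x := by
  rw [← hF, FiniteField.pow_card]

/-- Carlitz's theorem for the field of order 81. -/
theorem exists_affine_of_isPaleyAut {α : F} (hα : α ^ 4 = α ^ 2 + 1) {f : Equiv.Perm F}
    (hf : IsPaleyAut f) :
    ∃ s γ : F, s ≠ 0 ∧ IsSquare s ∧ ∃ i ≤ 3, ∀ x, f x = s * x ^ 3 ^ i + γ := by
  rw [isPaleyAut_iff] at hf
  have hs0 : f 1 - f 0 ≠ 0 := sub_ne_zero.2 (f.injective.ne one_ne_zero)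
  have hs : IsSquare (f 1 - f 0) := (hf 1 0).2 (by simp)
  refine ⟨f 1 - f 0, f 0, hs0, hs, ?_⟩
  set s := f 1 - f 0 with hs_def
  let g : F → F := fun x => s⁻¹ * (f x - f 0)
  have hg : ∀ x y, IsSquare (g x - g y) ↔ IsSquare (x - y) := fun x y => by
    simp only [g]
    rw [← mul_sub, sub_sub_sub_cancel_right, isSquare_mul_iff hs.inv (inv_ne_zero hs0), hf]
  have hg0 : g 0 = 0 := by simp [g]
  have hg1 : g 1 = 1 := by simp only [g]; rw [← hs_def, inv_mul_cancel₀ hs0]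
  obtain ⟨i, hi, hgα⟩ := map_generator h3 hα hF hg hg0 hg1
  have hexp : 3 ^ i * 3 ^ (4 - i) = 81 := by
    rw [← pow_add, Nat.add_sub_of_le (by omega)]; norm_num
  have hfix := eq_self_of_fixed_generator h3 hα hF (g := fun x => g x ^ 3 ^ (4 - i))
    (fun x y => by rw [isSquare_frobenius_sub h3, hg]) (by simp [hg0]) (by simp [hg1])
    (by simp only [hgα]; rw [← pow_mul, hexp, pow_eighty_one hF])
  refine ⟨i, hi, fun x => ?_⟩
  have hgx : g x = x ^ 3 ^ i := by
    conv_rhs => rw [← hfix x]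
    rw [← pow_mul, mul_comm, hexp, pow_eighty_one hF]
  rw [← hgx]
  simp only [g]
  rw [mul_inv_cancel_left₀ hs0, sub_add_cancel]

theorem exists_isPaleyAut {s : F} (hs0 : s ≠ 0) (hs : IsSquare s) (γ : F) {i : ℕ} (hi : i ≤ 4) :
    ∃ f : Equiv.Perm F, IsPaleyAut f ∧ ∀ x, f x = s * x ^ 3 ^ i + γ := by
  have hinj : Function.Injective fun x : F => s * x ^ 3 ^ i + γ := fun x y h => by
    have h' : x ^ 3 ^ i = y ^ 3 ^ i := mul_left_cancel₀ hs0 (add_right_cancel h)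
    have hexp : 3 ^ i * 3 ^ (4 - i) = 81 := by
      rw [← pow_add, Nat.add_sub_of_le hi]; norm_num
    rw [← pow_eighty_one hF x, ← pow_eighty_one hF y, ← hexp, pow_mul, pow_mul, h']
  refine ⟨Equiv.ofBijective _ (Finite.injective_iff_bijective.1 hinj), ?_, fun x => rfl⟩
  rw [isPaleyAut_iff]
  intro x y
  simp only [Equiv.ofBijective_apply]
  rw [add_sub_add_right_eq_sub, ← mul_sub, isSquare_mul_iff hs hs0, isSquare_frobenius_sub h3]

end Automorphisms

/-! ### The clique and its images -/

section Clique

/-- The codes of `0, 1, δ, α + δ ^ 5, δ * (α + δ ^ 5)`, where `δ = α ^ 2`. -/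
def cliqueCodes : List ℕ := [0, 1, 9, 21, 47]

/-- Exponentiation on codes, by `1` or `3`. -/
def powCode (n η : ℕ) : ℕ := bif η == 1 then n else mulCode n (mulCode n n)

theorem eq_one_of_affine_code : ∀ η ∈ [1, 3], ∀ η' ∈ [1, 3], ∀ k ∈ cliqueCodes,
    ∀ l ∈ cliqueCodes, subCode (powCode l η') (powCode k η') ≠ 0 →
    (∀ n ∈ cliqueCodes, ∃ m ∈ cliqueCodes,
      addCode (mulCode (subCode (powCode l η') (powCode k η')) (powCode n η)) (powCode k η') =
        powCode m η') →
    η = η' ∧ subCode (powCode l η') (powCode k η') = 1 ∧ powCode k η' = 0 := by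
  decide +kernel

theorem card_nonzero_square_codes :
    ((Finset.range 81).filter fun n => n ≠ 0 ∧ bit sqMask n = true).card = 40 := by
  decide +kernel

variable {F : Type*} [Field F] {α : F} (h3 : (3 : F) = 0) (hα : α ^ 4 = α ^ 2 + 1)

include h3 hα

theorem ofCode_powCode (n : ℕ) {η : ℕ} (hη : η ∈ ({1, 3} : Set ℕ)) :
    ofCode α (powCode n η) = ofCode α n ^ η := by
  rcases hη with rfl | rfl
  · simp [powCode]
  · change ofCode α (mulCode n (mulCode n n)) = _
    rw [ofCode_mulCode h3 hα, ofCode_mulCode h3 hα]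
    ring

theorem clique_eq_image {δ : F} (hδ : α ^ 2 = δ) :
    ({0, 1, δ, α + δ ^ 5, δ * (α + δ ^ 5)} : Set F) = ofCode α '' {n | n ∈ cliqueCodes} := by
  have e : {n | n ∈ cliqueCodes} = ({0, 1, 9, 21, 47} : Set ℕ) := by
    ext n; simp [cliqueCodes]
  have hα8 : α ^ 8 = -1 := by
    linear_combination (α ^ 4 + α ^ 2 + 2) * hα + (α ^ 2 + 1) * h3
  have h21 : α + δ ^ 5 = ofCode α 21 := by
    rw [← hδ]
    norm_num [ofCode]
    linear_combination α ^ 2 * hα8 - α ^ 2 * h3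
  have h47 : δ * (α + δ ^ 5) = ofCode α 47 := by
    rw [h21, ← hδ]
    norm_num [ofCode]
    linear_combination 2 * hα
  have h9 : δ = ofCode α 9 := by rw [← hδ]; norm_num [ofCode]
  have h0 : ofCode α 0 = 0 := by simp [ofCode]
  have h1 : ofCode α 1 = 1 := by simp [ofCode]
  rw [e, h47, h21]
  simp only [Set.image_insert_eq, Set.image_singleton, h0, h1, ← h9]

theorem image_pow_nine_clique {δ : F} (hδ : α ^ 2 = δ) :
    ∃ w : F, w * (α + δ ^ 5) = 1 ∧
      (fun x : F => x ^ 9) '' {0, 1, δ, α + δ ^ 5, δ * (α + δ ^ 5)} =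
        (fun x : F => w * x) '' {0, 1, δ, α + δ ^ 5, δ * (α + δ ^ 5)} := by
  have hα8 : α ^ 8 = -1 := by
    linear_combination (α ^ 4 + α ^ 2 + 2) * hα + (α ^ 2 + 1) * h3
  have h5 : δ ^ 5 = -α ^ 2 := by rw [← hδ]; linear_combination α ^ 2 * hα8
  have hw : (-α - α ^ 2) * (α - α ^ 2) = 1 := by linear_combination hα
  have hcube : ∀ x y : F, (x + y) ^ 3 = x ^ 3 + y ^ 3 := fun x y => by
    linear_combination (x ^ 2 * y + x * y ^ 2) * h3
  have hδ9 : δ ^ 9 = δ := by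
    rw [← hδ]; linear_combination (α ^ 10 - α ^ 2) * hα8
  have hz9 : (α - α ^ 2) ^ 9 = -α - α ^ 2 := by
    rw [sub_eq_add_neg, show (9 : ℕ) = 3 * 3 from rfl, pow_mul, hcube, hcube]
    linear_combination (α - α ^ 10 + α ^ 2) * hα8
  refine ⟨-α - α ^ 2, by rw [h5, ← sub_eq_add_neg, hw], ?_⟩
  rw [h5, ← sub_eq_add_neg]
  simp only [Set.image_insert_eq, Set.image_singleton, mul_pow, hδ9, hz9, mul_left_comm _ δ, hw]
  ext x
  simp only [Set.mem_insert_iff, Set.mem_singleton_iff, mul_zero, mul_one, one_pow, ne_eq,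
    OfNat.ofNat_ne_zero, not_false_eq_true, zero_pow, mul_comm _ δ]
  tauto

variable [Fintype F] (hF : Fintype.card F = 81)

include hF

theorem ncard_nonzero_squares : {s : F | s ≠ 0 ∧ IsSquare s}.ncard = 40 := by
  have h0 : ofCode α 0 = 0 := by simp [ofCode]
  have e : {s : F | s ≠ 0 ∧ IsSquare s} =
      ofCode α '' ((Finset.range 81).filter fun n => n ≠ 0 ∧ bit sqMask n = true : Finset ℕ) := by
    ext s
    obtain ⟨n, hn, rfl⟩ := exists_ofCode h3 hα hF s
    simp only [Set.mem_ofPred_eq, Set.mem_image, Finset.coe_filter, Finset.mem_range,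
      isSquare_ofCode h3 hα hF hn]
    constructor
    · rintro ⟨h, h'⟩
      exact ⟨n, ⟨hn, fun hn0 => h (by rw [hn0, h0]), h'⟩, rfl⟩
    · rintro ⟨m, ⟨hm, hm0, hm'⟩, hmn⟩
      obtain rfl := ofCode_injOn h3 hα hm hn hmn
      exact ⟨ofCode_ne_zero h3 hα hm hm0, hm'⟩
  rw [e, Set.InjOn.ncard_image, Set.ncard_coe_finset, card_nonzero_square_codes]
  intro m hm n hn h
  simp only [Finset.coe_filter, Finset.mem_range, Set.mem_ofPred_eq] at hm hn
  exact ofCode_injOn h3 hα hm.1 hn.1 h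

omit [Fintype F] hF in
theorem eq_one_of_affine {η η' : ℕ} (hη : η ∈ ({1, 3} : Set ℕ)) (hη' : η' ∈ ({1, 3} : Set ℕ))
    {a b : F} (ha : a ≠ 0)
    (h : ∀ x ∈ ofCode α '' {n | n ∈ cliqueCodes}, ∃ y ∈ ofCode α '' {n | n ∈ cliqueCodes},
      a * x ^ η + b = y ^ η') : η = η' ∧ a = 1 ∧ b = 0 := by
  have h0 : ofCode α 0 = 0 := by simp [ofCode]
  have h1 : ofCode α 1 = 1 := by simp [ofCode]
  have hη0 : η ≠ 0 := by rintro rfl; simp at hη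
  have hpow : ∀ m ∈ cliqueCodes, ∀ η ∈ [1, 3], powCode m η < 81 := by decide +kernel
  obtain ⟨_, ⟨k, hk, rfl⟩, hkb⟩ := h _ ⟨0, by simp [cliqueCodes], rfl⟩
  obtain ⟨_, ⟨l, hl, rfl⟩, hlb⟩ := h _ ⟨1, by simp [cliqueCodes], rfl⟩
  rw [h0, zero_pow hη0, mul_zero, zero_add, ← ofCode_powCode h3 hα k hη'] at hkb
  rw [h1, one_pow, mul_one, ← ofCode_powCode h3 hα l hη', hkb, ← eq_sub_iff_add_eq,
    ← ofCode_subCode h3] at hlb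
  subst hkb hlb
  obtain ⟨hηη', ha1, hb0⟩ := eq_one_of_affine_code η (by simpa using hη) η' (by simpa using hη')
    k hk l hl (fun ha0 => ha (by rw [ha0, h0])) fun n hn => by
      obtain ⟨_, ⟨m, hm, rfl⟩, hmn⟩ := h _ ⟨n, hn, rfl⟩
      refine ⟨m, hm, ofCode_injOn h3 hα (code_lt ..) (hpow m hm η' (by simpa using hη')) ?_⟩
      rw [ofCode_addCode h3, ofCode_mulCode h3 hα, ofCode_powCode h3 hα n hη,
        ofCode_powCode h3 hα m hη', hmn]
  exact ⟨hηη', by rw [ha1, h1], by rw [hb0, h0]⟩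

theorem ncard_images_clique {C : Set F} (hC : C = ofCode α '' {n | n ∈ cliqueCodes}) :
    {D : Set F | ∃ s γ : F, s ≠ 0 ∧ IsSquare s ∧ ∃ η ∈ ({1, 3} : Set ℕ),
      D = (fun x : F => s * x ^ η + γ) '' C}.ncard = 6480 := by
  have e : {D : Set F | ∃ s γ : F, s ≠ 0 ∧ IsSquare s ∧ ∃ η ∈ ({1, 3} : Set ℕ),
      D = (fun x : F => s * x ^ η + γ) '' C} =
      (fun p : F × F × ℕ => (fun x : F => p.1 * x ^ p.2.2 + p.2.1) '' C) ''
        ({s : F | s ≠ 0 ∧ IsSquare s} ×ˢ (Set.univ : Set F) ×ˢ ({1, 3} : Set ℕ)) := by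
    ext D
    constructor
    · rintro ⟨s, γ, hs0, hs, η, hη, rfl⟩
      exact ⟨(s, γ, η), ⟨⟨hs0, hs⟩, trivial, hη⟩, rfl⟩
    · rintro ⟨⟨s, γ, η⟩, ⟨⟨hs0, hs⟩, -, hη⟩, rfl⟩
      exact ⟨s, γ, hs0, hs, η, hη, rfl⟩
  rw [e, Set.InjOn.ncard_image, Set.ncard_prod, Set.ncard_prod,
    ncard_nonzero_squares h3 hα hF, Set.ncard_univ, Nat.card_eq_fintype_card, hF,
    Set.ncard_pair (by norm_num)]
  rintro ⟨s, γ, η⟩ ⟨⟨hs0, -⟩, -, hη⟩ ⟨s', γ', η'⟩ ⟨⟨hs0', -⟩, -, hη'⟩ h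
  simp only at h hs0 hs0' hη hη'
  obtain ⟨rfl, ha, hb⟩ := eq_one_of_affine h3 hα hη hη' (a := s'⁻¹ * s)
    (b := s'⁻¹ * (γ - γ')) (mul_ne_zero (inv_ne_zero hs0') hs0) (by
      rw [← hC]
      intro x hx
      obtain ⟨y, hy, hyx⟩ := h ▸ Set.mem_image_of_mem (fun x : F => s * x ^ η + γ) hx
      refine ⟨y, hy, ?_⟩
      simp only at hyx
      rw [← mul_right_inj' hs0']
      field_simp
      linear_combination -hyx)
  have hs : s = s' := by rw [inv_mul_eq_one₀ hs0'] at ha; exact ha.symm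
  have hγ : γ = γ' := by
    rcases mul_eq_zero.1 hb with hb | hb
    · exact absurd hb (inv_ne_zero hs0')
    · exact sub_eq_zero.1 hb
  rw [hs, hγ]

theorem paleyOrbit_clique {δ : F} (hδ : α ^ 2 = δ) (hz : IsSquare (α + δ ^ 5)) :
    paleyOrbit ({0, 1, δ, α + δ ^ 5, δ * (α + δ ^ 5)} : Set F)
      = {D : Set F | ∃ s γ : F, s ≠ 0 ∧ IsSquare s ∧ ∃ η ∈ ({1, 3} : Set ℕ),
          D = (fun x : F => s * x ^ η + γ) ''
            ({0, 1, δ, α + δ ^ 5, δ * (α + δ ^ 5)} : Set F)} := by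
  obtain ⟨w, hwz, hw9⟩ := image_pow_nine_clique h3 hα hδ
  have hw0 : w ≠ 0 := left_ne_zero_of_mul_eq_one hwz
  have hw : IsSquare w := by
    have : w = w ^ 2 * (α + δ ^ 5) := by linear_combination -w * hwz
    rw [this]
    exact IsSquare.mul ⟨w, sq w⟩ hz
  generalize ({0, 1, δ, α + δ ^ 5, δ * (α + δ ^ 5)} : Set F) = C at hw9 ⊢
  have himage : ∀ g : F → F,
      (fun x => g (x ^ 9)) '' C = (fun x => g (w * x)) '' C := fun g => by
    have := congrArg (fun S => g '' S) hw9
    simpa only [Set.image_image] using this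
  ext D
  constructor
  · rintro ⟨f, hf, rfl⟩
    obtain ⟨s, γ, hs0, hs, i, hi, hfi⟩ := exists_affine_of_isPaleyAut h3 hF hα hf
    rw [show ⇑f = fun x => s * x ^ 3 ^ i + γ from funext hfi]
    interval_cases i
    · exact ⟨s, γ, hs0, hs, 1, by simp, by simp⟩
    · exact ⟨s, γ, hs0, hs, 3, by simp, by simp⟩
    · refine ⟨s * w, γ, mul_ne_zero hs0 hw0, hs.mul hw, 1, by simp, ?_⟩
      refine (himage fun x => s * x + γ).trans ?_
      simp only [mul_assoc, pow_one]
    · refine ⟨s * w ^ 3, γ, mul_ne_zero hs0 (pow_ne_zero 3 hw0), hs.mul (hw.pow 3), 3, by simp, ?_⟩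
      have := himage fun x => s * x ^ 3 + γ
      simp only [mul_pow, ← pow_mul, ← mul_assoc] at this
      exact this
  · rintro ⟨s, γ, hs0, hs, η, hη, rfl⟩
    obtain ⟨i, hi, rfl⟩ : ∃ i ≤ 4, 3 ^ i = η := by
      rcases hη with rfl | rfl
      exacts [⟨0, by norm_num, rfl⟩, ⟨1, by norm_num, rfl⟩]
    obtain ⟨f, hf, hfx⟩ := exists_isPaleyAut h3 hF hs0 hs γ hi
    exact ⟨f, hf, by rw [← funext hfx]⟩

end Clique

/-! ### The minimal polynomial of the generator -/

section Generator

variable {F : Type*} [Field F] [Fintype F] (hF : Fintype.card F = 81)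

include hF

theorem three_eq_zero : (3 : F) = 0 := by
  have h : ((81 : ℕ) : F) = 0 := by rw [← hF]; exact Nat.cast_card_eq_zero F
  have h' : (3 : F) ^ 4 = 0 := by norm_num at h ⊢; exact h
  exact pow_eq_zero_iff (by norm_num) |>.1 h'

theorem generator_pow_four {δ α : F} (hδ : orderOf δ = 8) (hα : α ^ 2 = δ)
    (hS : IsSquare (α + δ)) : α ^ 4 = α ^ 2 + 1 := by
  have h3 := three_eq_zero hF
  have h8 : δ ^ 8 = 1 := by rw [← hδ, pow_orderOf_eq_one]
  have h4 : δ ^ 4 ≠ 1 := fun h => by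
    have := orderOf_dvd_of_pow_eq_one h
    rw [hδ] at this
    norm_num at this
  have h4' : δ ^ 4 = -1 := by
    have : (δ ^ 4 - 1) * (δ ^ 4 + 1) = 0 := by linear_combination h8
    rcases mul_eq_zero.1 this with h | h
    · exact absurd (sub_eq_zero.1 h) h4
    · exact eq_neg_of_add_eq_zero_left h
  have hfac : (δ ^ 2 - δ - 1) * (δ ^ 2 + δ - 1) = 0 := by
    linear_combination h4' - δ ^ 2 * h3
  rcases mul_eq_zero.1 hfac with h | h
  · rw [← hα] at h
    linear_combination h
  · exfalso
    have hcube : ∀ x y : F, (x + y) ^ 3 = x ^ 3 + y ^ 3 := fun x y => by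
      linear_combination (x ^ 2 * y + x * y ^ 2) * h3
    have hα8 : α ^ 8 = -1 := by rw [← h4', ← hα]; ring
    have h10 : (α + δ) ^ 10 = 1 + δ := by
      have h9 : (α + δ) ^ 9 = -α + δ := by
        rw [show (9 : ℕ) = 3 * 3 from rfl, pow_mul, hcube, hcube]
        linear_combination α * hα8 + δ * h8
      rw [pow_succ, h9]
      linear_combination h - hα - δ * h3
    have h40 : (α + δ) ^ 40 = -1 := by
      rw [show (40 : ℕ) = 10 + 10 * 3 from rfl, pow_add, pow_mul, h10, hcube]
      linear_combination h4' + (δ - 1) * h + δ * h3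
    obtain ⟨r, hr⟩ := hS
    have hr0 : r ≠ 0 := by
      rintro rfl
      rw [hr] at h40
      norm_num at h40
    have hr80 : r ^ 80 = 1 := by
      have := FiniteField.pow_card_sub_one_eq_one r hr0
      rwa [hF] at this
    rw [hr, ← sq, ← pow_mul, hr80] at h40
    exact one_ne_zero (α := F) (by linear_combination h3 - h40)

end Generator

end Paley81

theorem orbit_C9 (F : Type*) [Field F] [Fintype F] (hF : Fintype.card F = 81)
    (δ α : F) (hδ : orderOf δ = 8) (hα : α ^ 2 = δ)
    (hS : {y : F | IsSquare y ∧ ∃ x : F, x ^ 9 = x ∧ y = x + α}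
        = {α + δ, α + δ ^ 2, α + δ ^ 5, α + δ ^ 6}) :
    paleyOrbit ({0, 1, δ, α + δ ^ 5, δ * (α + δ ^ 5)} : Set F)
      = {D : Set F | ∃ s γ : F, s ≠ 0 ∧ IsSquare s ∧ ∃ η ∈ ({1, 3} : Set ℕ),
          D = (fun x : F => s * x ^ η + γ) ''
            ({0, 1, δ, α + δ ^ 5, δ * (α + δ ^ 5)} : Set F)} ∧
    (paleyOrbit ({0, 1, δ, α + δ ^ 5, δ * (α + δ ^ 5)} : Set F)).ncard = 6480 := by
  have h3 := Paley81.three_eq_zero hF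
  have hsq1 : IsSquare (α + δ) := by
    have h : α + δ ∈ ({α + δ, α + δ ^ 2, α + δ ^ 5, α + δ ^ 6} : Set F) := by simp
    rw [← hS] at h
    exact h.1
  have hsq5 : IsSquare (α + δ ^ 5) := by
    have h : α + δ ^ 5 ∈ ({α + δ, α + δ ^ 2, α + δ ^ 5, α + δ ^ 6} : Set F) := by simp
    rw [← hS] at h
    exact h.1
  have hα4 := Paley81.generator_pow_four hF hδ hα hsq1
  rw [Paley81.paleyOrbit_clique h3 hα4 hF hα hsq5]
  exact ⟨rfl, Paley81.ncard_images_clique h3 hα4 hF (Paley81.clique_eq_image h3 hα4 hα)⟩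
end

section
/- Let F be the finite field of order 289 and let α ∈ F satisfy α² = 10. Set C := {0} ∪ {1, 4, 16} ∪ {α+7, 4(α+7), 16(α+7)} ∪ {4(α+10)}, i.e. the clique C_17^E of the paper, with vertex set {0, 1, 4, 16, 13, α+7, 4(α+7), 16(α+7), 4(α+10)} where 13 = 16·4·... (explicitly C := {0, 1, 4, 16, 13, α+7, 4(α+7), 16(α+7), 4(α+10)}). Then the orbit of C under the natural action of the automorphism group of the Paley graph P(289) on vertex subsets has cardinality 83232, equal to the order of the automorphism group. -/
section PowerSums

variable {F : Type*} [Field F] [Fintype F]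

theorem charP_seventeen (hF : Fintype.card F = 289) : CharP F 17 := by
  obtain ⟨p, hp⟩ := CharP.exists F
  obtain ⟨n, hprime, hn⟩ := FiniteField.card F p
  have hdvd : p ∣ 17 ^ 2 := by
    rw [show 17 ^ 2 = p ^ (n : ℕ) by rw [← hn, hF]; norm_num]
    exact dvd_pow_self p n.pos.ne'
  rw [← (Nat.prime_dvd_prime_iff_eq hprime (by norm_num)).1 (hprime.dvd_of_dvd_pow hdvd)]
  exact hp

theorem sum_pow_eq_ite {i : ℕ} (hi : i ≠ 0) :
    ∑ x : F, x ^ i = if Fintype.card F - 1 ∣ i then -1 else 0 := by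
  classical
  rw [← FiniteField.sum_pow_units F i,
    ← Finset.sum_subset (Finset.subset_univ (Finset.univ.map ⟨_, Units.val_injective (α := F)⟩))]
  · simp
  · intro x _ hx
    have hx0 : x = 0 := by
      by_contra h
      exact hx (Finset.mem_map.2 ⟨Units.mk0 x h, Finset.mem_univ _, rfl⟩)
    rw [hx0, zero_pow hi]

theorem sum_sub_pow_mul_pow (hF : Fintype.card F = 289) {k : ℕ} (hk : 1 ≤ k) (hk' : k ≤ 144)
    (x : F) :
    ∑ y : F, (x - y) ^ 144 * y ^ (144 + k) =
      -((-1) ^ (144 - k) * (Nat.choose 144 k : F)) * x ^ k := by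
  have hpow : ∀ j ∈ Finset.range 145,
      ∑ y : F, y ^ (144 - j) * y ^ (144 + k) = if j = k then (-1 : F) else 0 := by
    intro j hj
    rw [Finset.mem_range] at hj
    simp_rw [← pow_add]
    rw [sum_pow_eq_ite (by omega), hF]
    congr 1
    rw [eq_iff_iff]
    omega
  calc ∑ y : F, (x - y) ^ 144 * y ^ (144 + k)
      = ∑ y : F, ∑ j ∈ Finset.range 145,
          x ^ j * (-1) ^ (144 - j) * (Nat.choose 144 j : F) * (y ^ (144 - j) * y ^ (144 + k)) := by
        refine Finset.sum_congr rfl fun y _ => ?_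
        rw [sub_eq_add_neg, add_pow, Finset.sum_mul]
        refine Finset.sum_congr rfl fun j _ => ?_
        rw [neg_pow y]
        ring
    _ = ∑ j ∈ Finset.range 145,
          x ^ j * (-1) ^ (144 - j) * (Nat.choose 144 j : F) * if j = k then (-1 : F) else 0 := by
        rw [Finset.sum_comm]
        refine Finset.sum_congr rfl fun j hj => ?_
        rw [← Finset.mul_sum, hpow j hj]
    _ = _ := by
        simp only [mul_ite, mul_zero, Finset.sum_ite_eq', Finset.mem_range]
        rw [if_pos (by omega)]
        ring

end PowerSums

section Bivariate

open MvPolynomial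

variable {F : Type*} [Field F]

theorem degreeOf_X_sub_C_pow_le (i j : Fin 2) (a : F) (n : ℕ) :
    degreeOf i ((X j - C a : MvPolynomial (Fin 2) F) ^ n) ≤ if i = j then n else 0 := by
  refine (degreeOf_pow_le _ _ _).trans ?_
  refine (Nat.mul_le_mul_left n (degreeOf_sub_le _ _ _)).trans ?_
  rw [degreeOf_C, degreeOf_X]
  split_ifs <;> simp

/-- A bivariate polynomial of degree at most `1` in each variable evaluates as a bilinear form. -/
theorem exists_eval_eq_of_degreeOf_le_one {P : MvPolynomial (Fin 2) F}
    (hP : ∀ i, degreeOf i P ≤ 1) :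
    ∃ a b c d : F, ∀ s t : F, eval ![s, t] P = a + b * s + c * t + d * (s * t) := by
  classical
  let m : Fin 2 × Fin 2 → Fin 2 →₀ ℕ := fun p => Finsupp.equivFunOnFinite.symm ![p.1, p.2]
  have hm : Function.Injective m := fun p q h => by
    have h0 := DFunLike.congr_fun h 0
    have h1 := DFunLike.congr_fun h 1
    simp only [m, Finsupp.equivFunOnFinite_symm_apply_apply, Matrix.cons_val_zero,
      Matrix.cons_val_one] at h0 h1
    exact Prod.ext (Fin.ext h0) (Fin.ext h1)
  have hsupp : P.support ⊆ Finset.univ.image m := fun e he => by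
    have h0 := degreeOf_le_iff.1 (hP 0) e he
    have h1 := degreeOf_le_iff.1 (hP 1) e he
    refine Finset.mem_image.2 ⟨(⟨e 0, by omega⟩, ⟨e 1, by omega⟩), Finset.mem_univ _, ?_⟩
    ext i
    fin_cases i <;> simp [m]
  refine ⟨P.coeff (m (0, 0)), P.coeff (m (1, 0)), P.coeff (m (0, 1)), P.coeff (m (1, 1)),
    fun s t => ?_⟩
  rw [eval_eq', Finset.sum_subset hsupp fun e _ he => by rw [notMem_support_iff.1 he, zero_mul],
    Finset.sum_image hm.injOn, Fintype.sum_prod_type]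
  simp [Fin.sum_univ_two, m]
  ring

/-- If `P ^ 2` has degree at most `n` in each variable, `P` has degree at most `n / 2`. -/
theorem degreeOf_le_of_sq {P Q : MvPolynomial (Fin 2) F} {n : ℕ} (h : P ^ 2 = Q)
    (hQ : ∀ i, degreeOf i Q ≤ 2 * n) (i : Fin 2) : degreeOf i P ≤ n := by
  rcases eq_or_ne P 0 with rfl | hP
  · simp
  · have := hQ i
    rw [← h, degreeOf_pow_eq i P 2 hP] at this
    omega

theorem degreeOf_sq_le {P : MvPolynomial (Fin 2) F} {n : ℕ} (hP : ∀ i, degreeOf i P ≤ n)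
    (i : Fin 2) : degreeOf i (P ^ 2) ≤ 2 * n :=
  (degreeOf_pow_le _ _ _).trans (Nat.mul_le_mul_left 2 (hP i))

theorem degreeOf_bilinear_le (b c d : F) (i : Fin 2) :
    degreeOf i (C b * X 0 + C c * X 1 + C d * (X 0 * X 1) : MvPolynomial (Fin 2) F) ≤ 1 := by
  refine (degreeOf_add_le _ _ _).trans (max_le ((degreeOf_add_le _ _ _).trans (max_le ?_ ?_)) ?_)
  · refine (degreeOf_C_mul_le _ _ _).trans ?_
    rw [degreeOf_X]; split_ifs <;> simp
  · refine (degreeOf_C_mul_le _ _ _).trans ?_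
    rw [degreeOf_X]; split_ifs <;> simp
  · refine (degreeOf_C_mul_le _ _ _).trans ((degreeOf_mul_le _ _ _).trans ?_)
    rw [degreeOf_X, degreeOf_X]
    fin_cases i <;> simp

variable [Fintype F]

/-- A bivariate polynomial of degree at most `16` in each variable is determined by the function
`x ↦ P(x, x ^ 17)` on the field with `289` elements. -/
theorem eq_zero_of_eval_frobenius_eq_zero (hF : Fintype.card F = 289)
    {P : MvPolynomial (Fin 2) F} (hP : ∀ i, degreeOf i P ≤ 16)
    (h : ∀ x : F, eval ![x, x ^ 17] P = 0) : P = 0 := by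
  classical
  have hle : ∀ d ∈ P.support, d 0 ≤ 16 ∧ d 1 ≤ 16 := fun d hd =>
    ⟨(degreeOf_le_iff.1 (hP 0)) d hd, (degreeOf_le_iff.1 (hP 1)) d hd⟩
  set Q : Polynomial F := ∑ d ∈ P.support, Polynomial.monomial (d 0 + 17 * d 1) (P.coeff d)
    with hQ
  have hQ0 : Q = 0 := by
    refine Polynomial.eq_zero_of_natDegree_lt_card_of_eval_eq_zero Q Function.injective_id
      (fun x => ?_) ?_
    · rw [← h x, eval_eq', hQ, Polynomial.eval_finsetSum]
      refine Finset.sum_congr rfl fun d _ => ?_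
      simp only [Polynomial.eval_monomial, Fin.prod_univ_two, id, Matrix.cons_val_zero,
        Matrix.cons_val_one]
      rw [pow_add, pow_mul]
    · rw [hF]
      refine (Polynomial.natDegree_sum_le_of_forall_le (n := 288) _ _ fun d hd => ?_).trans_lt
        (by norm_num)
      have := hle d hd
      exact (Polynomial.natDegree_monomial_le _).trans (by omega)
  by_contra hne
  obtain ⟨d, hd⟩ := Finset.nonempty_iff_ne_empty.2 fun he => hne (support_eq_empty.1 he)
  have hcoeff : Q.coeff (d 0 + 17 * d 1) = P.coeff d := by
    rw [hQ, Polynomial.finsetSum_coeff, Finset.sum_eq_single d]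
    · simp
    · intro e he hed
      rw [Polynomial.coeff_monomial, if_neg]
      intro heq
      have h1 := hle d hd
      have h2 := hle e he
      apply hed
      ext i
      fin_cases i <;> simp <;> omega
    · exact fun h => absurd hd h
  rw [hQ0, Polynomial.coeff_zero] at hcoeff
  exact mem_support_iff.1 hd hcoeff.symm

theorem eq_of_eval_frobenius_eq (hF : Fintype.card F = 289)
    {P Q : MvPolynomial (Fin 2) F} (hP : ∀ i, degreeOf i P ≤ 16) (hQ : ∀ i, degreeOf i Q ≤ 16)
    (h : ∀ x : F, eval ![x, x ^ 17] P = eval ![x, x ^ 17] Q) : P = Q :=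
  sub_eq_zero.1 <| eq_zero_of_eval_frobenius_eq_zero hF
    (fun i => (degreeOf_sub_le _ _ _).trans (max_le (hP i) (hQ i)))
    fun x => by rw [map_sub, h x, sub_self]

/-- The low powers of a permutation preserving the quadratic character are given by bivariate
polynomials in `x` and `x ^ 17` of degree at most `8` in each variable. -/
theorem exists_bivariate_pow (hF : Fintype.card F = 289) (f : Equiv.Perm F)
    (hf : ∀ x y, (f x - f y) ^ 144 = (x - y) ^ 144) {k : ℕ} (hk : 1 ≤ k) (hk' : k ≤ 144)
    (hchoose : ¬ 17 ∣ Nat.choose 144 k) :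
    ∃ P : MvPolynomial (Fin 2) F, (∀ i, degreeOf i P ≤ 8) ∧
      ∀ x : F, eval ![x, x ^ 17] P = f x ^ k := by
  have := charP_seventeen hF
  have : Fact (Nat.Prime 17) := ⟨by norm_num⟩
  set c : F := -((-1) ^ (144 - k) * (Nat.choose 144 k : F)) with hc
  have hc0 : c ≠ 0 := by
    rw [hc, neg_ne_zero]
    refine mul_ne_zero (pow_ne_zero _ (neg_ne_zero.2 one_ne_zero)) ?_
    rwa [Ne, CharP.cast_eq_zero_iff F 17]
  refine ⟨∑ y : F, C (c⁻¹ * f y ^ (144 + k)) * ((X 0 - C y) ^ 8 * (X 1 - C (y ^ 17)) ^ 8),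
    fun i => ?_, fun x => ?_⟩
  · refine (degreeOf_sum_le _ _ _).trans (Finset.sup_le fun y _ => ?_)
    refine (degreeOf_C_mul_le _ _ _).trans ((degreeOf_mul_le _ _ _).trans ?_)
    refine (add_le_add (degreeOf_X_sub_C_pow_le _ _ _ _)
      (degreeOf_X_sub_C_pow_le _ _ _ _)).trans ?_
    fin_cases i <;> simp
  · have key : ∀ y : F, (x - y) ^ 8 * (x ^ 17 - y ^ 17) ^ 8 = (f x - f y) ^ 144 := fun y => by
      rw [hf, ← sub_pow_char (p := 17), ← pow_mul, ← pow_add]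
    simp only [map_sum, map_mul, map_pow, map_sub, eval_C, eval_X, Matrix.cons_val_zero,
      Matrix.cons_val_one]
    simp_rw [key]
    rw [Equiv.sum_comp f fun z => c⁻¹ * z ^ (144 + k) * (f x - z) ^ 144]
    simp_rw [mul_assoc, ← Finset.mul_sum, mul_comm (_ ^ (144 + k))]
    rw [sum_sub_pow_mul_pow hF hk hk', inv_mul_cancel_left₀ hc0]

/-- A permutation of the field with `289` elements preserving the quadratic character is
a polynomial of degree at most `1` in each of `x` and `x ^ 17`. -/
theorem exists_eq_bilinear (hF : Fintype.card F = 289) (f : Equiv.Perm F)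
    (hf : ∀ x y, (f x - f y) ^ 144 = (x - y) ^ 144) :
    ∃ a b c d : F, ∀ x : F, f x = a + b * x + c * x ^ 17 + d * (x * x ^ 17) := by
  obtain ⟨P₁, hP₁, h₁⟩ := exists_bivariate_pow hF f hf (k := 1) le_rfl (by norm_num) (by norm_num)
  obtain ⟨P₂, hP₂, h₂⟩ :=
    exists_bivariate_pow hF f hf (k := 2) (by norm_num) (by norm_num) (by norm_num [Nat.choose])
  obtain ⟨P₄, hP₄, h₄⟩ :=
    exists_bivariate_pow hF f hf (k := 4) (by norm_num) (by norm_num) (by norm_num [Nat.choose])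
  obtain ⟨P₈, hP₈, h₈⟩ :=
    exists_bivariate_pow hF f hf (k := 8) (by norm_num) (by norm_num) (by norm_num [Nat.choose])
  have sq_eq : ∀ {P Q : MvPolynomial (Fin 2) F} {k : ℕ}, (∀ i, degreeOf i P ≤ 8) →
      (∀ i, degreeOf i Q ≤ 8) → (∀ x : F, eval ![x, x ^ 17] P = f x ^ k) →
      (∀ x : F, eval ![x, x ^ 17] Q = f x ^ (2 * k)) → P ^ 2 = Q := fun hP hQ hPe hQe =>
    eq_of_eval_frobenius_eq hF (degreeOf_sq_le hP) (fun i => (hQ i).trans (by norm_num)) fun x => by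
      rw [map_pow, hPe, hQe, ← pow_mul, mul_comm]
  have d₄ : ∀ i, degreeOf i P₄ ≤ 4 := degreeOf_le_of_sq (sq_eq hP₄ hP₈ h₄ h₈) hP₈
  have d₂ : ∀ i, degreeOf i P₂ ≤ 2 := degreeOf_le_of_sq (sq_eq hP₂ hP₄ h₂ h₄) d₄
  have d₁ : ∀ i, degreeOf i P₁ ≤ 1 := degreeOf_le_of_sq (sq_eq hP₁ hP₂ h₁ h₂) d₂
  obtain ⟨a, b, c, d, h⟩ := exists_eval_eq_of_degreeOf_le_one d₁
  exact ⟨a, b, c, d, fun x => by rw [← pow_one (f x), ← h₁ x, h]⟩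

theorem bilinear_pow_mul_conj_pow (hF : Fintype.card F = 289) {b c d : F}
    (h : ∀ x : F, (b * x + c * x ^ 17 + d * (x * x ^ 17)) ^ 144 = x ^ 144) (s t : F) :
    (b * s + c * t + d * (s * t)) ^ 8 * (c ^ 17 * s + b ^ 17 * t + d ^ 17 * (s * t)) ^ 8 =
      s ^ 8 * t ^ 8 := by
  have := charP_seventeen hF
  have : Fact (Nat.Prime 17) := ⟨by norm_num⟩
  let P : F → F → F → MvPolynomial (Fin 2) F :=
    fun b c d => C b * X 0 + C c * X 1 + C d * (X 0 * X 1)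
  have heval : ∀ b c d s t, eval ![s, t] (P b c d) = b * s + c * t + d * (s * t) := by
    intros
    simp [P]
  have key : P b c d ^ 8 * P (c ^ 17) (b ^ 17) (d ^ 17) ^ 8 = (X 0 ^ 8 * X 1 ^ 8) := by
    refine eq_of_eval_frobenius_eq hF (fun i => ?_) (fun i => ?_) fun x => ?_
    · refine (degreeOf_mul_le _ _ _).trans ?_
      refine (add_le_add (degreeOf_pow_le _ _ _) (degreeOf_pow_le _ _ _)).trans ?_
      have h1 := degreeOf_bilinear_le b c d i
      have h2 := degreeOf_bilinear_le (c ^ 17) (b ^ 17) (d ^ 17) i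
      simp only [P]
      omega
    · refine (degreeOf_mul_le _ _ _).trans ?_
      refine (add_le_add (degreeOf_pow_le _ _ _) (degreeOf_pow_le _ _ _)).trans ?_
      rw [degreeOf_X, degreeOf_X]
      split_ifs <;> norm_num
    · have hx : (x ^ 17) ^ 17 = x := by
        rw [← pow_mul, show 17 * 17 = Fintype.card F by rw [hF], FiniteField.pow_card]
      have hconj : c ^ 17 * x + b ^ 17 * x ^ 17 + d ^ 17 * (x * x ^ 17) =
          (b * x + c * x ^ 17 + d * (x * x ^ 17)) ^ 17 := by
        rw [add_pow_char (p := 17), add_pow_char (p := 17)]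
        simp only [mul_pow, hx]
        ring
      simp only [map_mul, map_pow, heval, eval_X, Matrix.cons_val_zero, Matrix.cons_val_one]
      rw [hconj, ← pow_mul, ← pow_add, h x]
      ring
  have := congrArg (eval ![s, t]) key
  simpa only [map_mul, map_pow, heval, eval_X, Matrix.cons_val_zero, Matrix.cons_val_one]
    using this

end Bivariate

section Automorphisms

variable {F : Type*} [Field F]

theorem IsPaleyAut.symm {f : Equiv.Perm F} (hf : IsPaleyAut f) : IsPaleyAut f.symm := fun a b => by
  simpa using (hf (f.symm a) (f.symm b)).symm

variable [Fintype F]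

/-- A permutation of the field with `289` elements fixing `0` and preserving the quadratic
character is, up to a scalar, a field automorphism. -/
theorem exists_eq_mul_or_eq_mul_frobenius (hF : Fintype.card F = 289) (f : Equiv.Perm F)
    (hf : ∀ x y, (f x - f y) ^ 144 = (x - y) ^ 144) (hf0 : f 0 = 0) :
    ∃ b : F, (∀ x, f x = b * x) ∨ (∀ x, f x = b * x ^ 17) := by
  have := charP_seventeen hF
  obtain ⟨a, b, c, d, h⟩ := exists_eq_bilinear hF f hf
  have ha : a = 0 := by simpa [hf0] using (h 0).symm
  simp only [ha, zero_add] at h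
  have key := bilinear_pow_mul_conj_pow hF (b := b) (c := c) (d := d) fun x => by
    rw [← h x]
    simpa [hf0] using hf x 0
  have hzero : ∀ s t : F, b * s + c * t + d * (s * t) = 0 → s * t = 0 := fun s t hst => by
    have hk := key s t
    rw [hst, zero_pow (by norm_num), zero_mul, ← mul_pow] at hk
    exact pow_eq_zero_iff (by norm_num) |>.1 hk.symm
  have hneg : (1 : F) ≠ -1 := fun h' => by
    have h2 : ((2 : ℕ) : F) = 0 := by
      push_cast
      linear_combination h'
    rw [CharP.cast_eq_zero_iff F 17] at h2
    omega
  by_cases hb : b = 0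
  · subst hb
    by_cases hd : d = 0
    · exact ⟨c, Or.inr fun x => by rw [h x, hd]; ring⟩
    · by_cases hc : c = 0
      · refine absurd (f.injective ?_) hneg
        rw [h, h, hc]
        ring
      · have := hzero (-c / d) 1 (by field_simp; ring)
        simp [hc, hd] at this
  · by_cases hc : c = 0
    · subst hc
      by_cases hd : d = 0
      · exact ⟨b, Or.inl fun x => by rw [h x, hd]; ring⟩
      · have := hzero 1 (-b / d) (by field_simp; ring)
        simp [hb, hd] at this
    · obtain ⟨s, hs, hcs⟩ : ∃ s : F, s ≠ 0 ∧ c + d * s ≠ 0 := by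
        by_contra! hcon
        have h1 := hcon 1 one_ne_zero
        have h2 := hcon (-1) (neg_ne_zero.2 one_ne_zero)
        have h3 : c * (1 - -1) = 0 := by linear_combination h1 + h2
        exact mul_ne_zero hc (sub_ne_zero.2 hneg) h3
      have := hzero s (-(b * s) / (c + d * s)) (by
        linear_combination mul_div_cancel₀ (-(b * s)) hcs)
      simp [hb, hs, hcs] at this

theorem ringChar_ne_two (hF : Fintype.card F = 289) : ringChar F ≠ 2 := by
  have := charP_seventeen hF
  rw [ringChar.eq F 17]
  norm_num

theorem IsPaleyAut.sub_pow_eq (hF : Fintype.card F = 289) {f : Equiv.Perm F}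
    (hf : IsPaleyAut f) (x y : F) : (f x - f y) ^ 144 = (x - y) ^ 144 := by
  rcases eq_or_ne x y with rfl | hxy
  · simp
  have h1 : x - y ≠ 0 := sub_ne_zero.2 hxy
  have h2 : f x - f y ≠ 0 := sub_ne_zero.2 (f.injective.ne hxy)
  have hiff := hf x y
  simp only [hxy, f.injective.ne hxy, ne_eq, not_false_eq_true, true_and,
    FiniteField.isSquare_iff (ringChar_ne_two hF) h1,
    FiniteField.isSquare_iff (ringChar_ne_two hF) h2, hF] at hiff
  have d1 := FiniteField.pow_dichotomy (ringChar_ne_two hF) h1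
  have d2 := FiniteField.pow_dichotomy (ringChar_ne_two hF) h2
  rw [hF] at d1 d2
  norm_num at hiff d1 d2
  rcases d1 with d1 | d1 <;> rcases d2 with d2 | d2 <;> simp_all

theorem ncard_isSquare_units (hF : Fintype.card F = 289) :
    {u : Fˣ | IsSquare (u : F)}.ncard = 144 := by
  have hset : {u : Fˣ | IsSquare (u : F)} = ((powMonoidHom 2 : Fˣ →* Fˣ).range : Set Fˣ) := by
    ext u
    constructor
    · rintro ⟨r, hr⟩
      have hr0 : r ≠ 0 := fun h => u.ne_zero (by simp [hr, h])
      exact ⟨Units.mk0 r hr0, Units.ext (by simp [hr, sq])⟩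
    · rintro ⟨r, rfl⟩
      exact ⟨r, by simp [sq]⟩
  have hcard : Nat.card Fˣ = 288 := by
    rw [Nat.card_units, Nat.card_eq_fintype_card, hF]
  rw [hset, ← Nat.card_coe_set_eq, SetLike.coe_sort_coe, IsCyclic.card_powMonoidHom_range, hcard]
  norm_num

/-- The permutation `x ↦ c + u * x` or, if `e` is true, `x ↦ c + u * x ^ p`. -/
noncomputable def semiaffinePerm (p : ℕ) [Fact p.Prime] [CharP F p] (c : F) (u : Fˣ) (e : Bool) :
    Equiv.Perm F :=
  ((bif e then (frobeniusEquiv F p).toEquiv else Equiv.refl F).trans u.mulLeft).trans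
    (Equiv.addLeft c)

theorem semiaffinePerm_apply (p : ℕ) [Fact p.Prime] [CharP F p] (c : F) (u : Fˣ) (e : Bool)
    (x : F) : semiaffinePerm p c u e x = c + u * x ^ (bif e then p else 1) := by
  cases e <;> simp [semiaffinePerm, frobeniusEquiv_apply, frobenius_def]

variable [CharP F 17] [Fact (Nat.Prime 17)]

theorem IsPaleyAut.exists_eq_semiaffinePerm (hF : Fintype.card F = 289) {f : Equiv.Perm F}
    (hf : IsPaleyAut f) :
    ∃ (c : F) (u : Fˣ) (e : Bool), IsSquare (u : F) ∧ f = semiaffinePerm 17 c u e := by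
  have h10 := (hf 1 0).2 ⟨one_ne_zero, by simp⟩
  obtain ⟨b, hb⟩ := exists_eq_mul_or_eq_mul_frobenius hF (f.trans (Equiv.subRight (f 0)))
    (fun x y => by simpa using hf.sub_pow_eq hF x y) (by simp)
  simp only [Equiv.trans_apply, Equiv.subRight_apply] at hb
  have hb1 : b = f 1 - f 0 := by rcases hb with hb | hb <;> simp [hb 1]
  refine ⟨f 0, Units.mk0 b (hb1 ▸ sub_ne_zero.2 h10.1), ?_⟩
  rcases hb with hb | hb
  · refine ⟨false, by simpa [hb1] using h10.2, Equiv.ext fun x => ?_⟩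
    simp [semiaffinePerm_apply, ← hb]
  · refine ⟨true, by simpa [hb1] using h10.2, Equiv.ext fun x => ?_⟩
    simp [semiaffinePerm_apply, ← hb]

theorem isPaleyAut_semiaffinePerm (c : F) {u : Fˣ}
    (hu : IsSquare (u : F)) (e : Bool) : IsPaleyAut (semiaffinePerm 17 c u e) := fun x y => by
  rw [(semiaffinePerm 17 c u e).injective.ne_iff]
  refine and_congr_right fun hxy => ?_
  have hsub : semiaffinePerm 17 c u e x - semiaffinePerm 17 c u e y =
      u * (x - y) ^ (bif e then 17 else 1) := by
    simp only [semiaffinePerm_apply]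
    cases e
    · simp [mul_sub]
    · simp [← mul_sub, sub_pow_char (p := 17)]
  obtain ⟨r, hr⟩ := hu
  have hr0 : r ≠ 0 := fun h => u.ne_zero (by simp [hr, h])
  have h1 : x - y ≠ 0 := sub_ne_zero.2 hxy
  rw [hsub, hr]
  constructor
  · rintro ⟨s, hs⟩
    cases e
    · exact ⟨s / r, by simp at hs; field_simp; linear_combination hs⟩
    · refine ⟨s / (r * (x - y) ^ 8), ?_⟩
      simp at hs
      field_simp
      linear_combination hs
  · rintro ⟨s, hs⟩
    exact ⟨r * s ^ (bif e then 17 else 1), by rw [hs]; ring⟩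

theorem semiaffinePerm_injective (hF : Fintype.card F = 289) :
    Function.Injective fun v : F × Fˣ × Bool => semiaffinePerm 17 v.1 v.2.1 v.2.2 := by
  rintro ⟨c, u, e⟩ ⟨c', u', e'⟩ h
  have happ : ∀ x : F, c + u * x ^ (bif e then 17 else 1) = c' + u' * x ^ (bif e' then 17 else 1) :=
    fun x => by
      simpa only [semiaffinePerm_apply] using DFunLike.congr_fun h x
  have hc : c = c' := by cases e <;> cases e' <;> simpa using happ 0
  subst hc
  have hu : u = u' := Units.ext (by simpa using happ 1)
  subst hu
  have hpow : ∀ x : F, x ^ (bif e then 17 else 1) = x ^ (bif e' then 17 else 1) := fun x => by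
    simpa using happ x
  have hfrob : ¬ ∀ x : F, x ^ 17 = x := fun hall => by
    have hX := Polynomial.eq_zero_of_natDegree_lt_card_of_eval_eq_zero
      (Polynomial.X ^ 17 - Polynomial.X : Polynomial F) Function.injective_id
      (fun x => by simp [hall x])
      (by rw [hF, FiniteField.X_pow_card_sub_X_natDegree_eq F (by norm_num)]; norm_num)
    exact FiniteField.X_pow_card_sub_X_ne_zero F (by norm_num) hX
  have he : e = e' := by
    cases e <;> cases e'
    · rfl
    · exact absurd (fun x => by simpa using (hpow x).symm) hfrob
    · exact absurd (fun x => by simpa using hpow x) hfrob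
    · rfl
  rw [he]

theorem ncard_isPaleyAut (hF : Fintype.card F = 289) :
    {f : Equiv.Perm F | IsPaleyAut f}.ncard = 83232 := by
  have hset : {f : Equiv.Perm F | IsPaleyAut f} =
      (fun v : F × Fˣ × Bool => semiaffinePerm 17 v.1 v.2.1 v.2.2) ''
        (Set.univ ×ˢ {u : Fˣ | IsSquare (u : F)} ×ˢ Set.univ) := by
    ext f
    constructor
    · intro hf
      obtain ⟨c, u, e, hu, rfl⟩ := IsPaleyAut.exists_eq_semiaffinePerm hF hf
      exact ⟨(c, u, e), ⟨trivial, hu, trivial⟩, rfl⟩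
    · rintro ⟨⟨c, u, e⟩, ⟨-, hu, -⟩, rfl⟩
      exact isPaleyAut_semiaffinePerm c hu e
  rw [hset, Set.ncard_image_of_injective _ (semiaffinePerm_injective hF), Set.ncard_prod,
    Set.ncard_prod, ncard_isSquare_units hF, Set.ncard_univ, Set.ncard_univ,
    Nat.card_eq_fintype_card, Nat.card_eq_fintype_card, hF, Fintype.card_bool]

end Automorphisms
/-- A set with trivial stabilizer has an orbit as large as the automorphism group. -/
theorem ncard_paleyOrbit_of_trivial_stab {F : Type*} [Field F] [Fintype F] {C : Set F}
    (hC : ∀ f : Equiv.Perm F, IsPaleyAut f → f '' C = C → f = Equiv.refl F) :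
    (paleyOrbit C).ncard = {f : Equiv.Perm F | IsPaleyAut f}.ncard := by
  have himage : paleyOrbit C = (fun f : Equiv.Perm F => f '' C) '' {f | IsPaleyAut f} := rfl
  rw [himage, Set.InjOn.ncard_image]
  intro f hf g hg hfg
  have h := hC (f.trans g.symm) (hf.trans hg.symm) (by
    simp only at hfg
    rw [Equiv.coe_trans, Set.image_comp, hfg, Equiv.symm_image_image])
  ext x
  have := DFunLike.congr_fun h x
  simpa [Equiv.symm_apply_eq] using this

section Clique

open QuadraticAlgebra

/-- The clique, viewed in `𝔽₁₇[α]`, where `α ^ 2 = 10`. -/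
def cliqueCoords : List (QuadraticAlgebra (ZMod 17) 10 0) :=
  [0, 1, 4, 16, 13, ω + 7, 4 * (ω + 7), 16 * (ω + 7), 4 * (ω + 10)]

theorem eq_zero_one_of_affine_mem : ∀ c ∈ cliqueCoords, ∀ d ∈ cliqueCoords, c ≠ d →
    (∀ z ∈ cliqueCoords, c + (d - c) * z ∈ cliqueCoords) → c = 0 ∧ d = 1 := by
  decide +kernel

theorem pow_eq_star_of_mem : ∀ z ∈ cliqueCoords, z ^ 17 = star z := by
  decide +kernel

theorem not_conj_affine_mem : ∀ c ∈ cliqueCoords, ∀ d ∈ cliqueCoords, c ≠ d →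
    ¬ ∀ z ∈ cliqueCoords, c + (d - c) * star z ∈ cliqueCoords := by
  decide +kernel

instance : Fact (∀ r : ZMod 17, r ^ 2 ≠ 10 + 0 * r) := ⟨by decide⟩

variable {F : Type*} [Field F] [Fintype F] [CharP F 17] [Fact (Nat.Prime 17)]

theorem IsPaleyAut.eq_refl_of_image_clique (hF : Fintype.card F = 289) {α : F} (hα : α ^ 2 = 10)
    {f : Equiv.Perm F} (hf : IsPaleyAut f) {C : Set F}
    (hC : C = {0, 1, 4, 16, 13, α + 7, 4 * (α + 7), 16 * (α + 7), 4 * (α + 10)})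
    (hfC : f '' C = C) : f = Equiv.refl F := by
  let _ : Algebra (ZMod 17) F := ZMod.algebra F 17
  let φ : QuadraticAlgebra (ZMod 17) 10 0 →ₐ[ZMod 17] F := QuadraticAlgebra.lift ⟨α, by
    rw [← sq, hα, Algebra.smul_def, map_ofNat]
    simp⟩
  have hφω : φ ω = α := by simp [φ]
  have hφinj : Function.Injective φ := φ.toRingHom.injective
  have hCφ : C = φ '' {z | z ∈ cliqueCoords} := by
    have hnum : ∀ (n : ℕ) [n.AtLeastTwo], φ ofNat(n) = ofNat(n) := fun n _ => map_ofNat φ n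
    ext x
    simp [hC, cliqueCoords, hφω, hnum, eq_comm]
  have hmem : ∀ z, φ z ∈ C ↔ z ∈ cliqueCoords := fun z => by
    rw [hCφ, hφinj.mem_set_image]
    rfl
  have hmaps : ∀ z ∈ cliqueCoords, ∃ w ∈ cliqueCoords, φ w = f (φ z) := fun z hz => by
    have : f (φ z) ∈ C := hfC ▸ Set.mem_image_of_mem f ((hmem z).2 hz)
    rwa [hCφ] at this
  obtain ⟨c, u, e, -, rfl⟩ := hf.exists_eq_semiaffinePerm hF
  obtain ⟨c', hc', hc⟩ := hmaps 0 (List.mem_cons_self ..)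
  obtain ⟨d', hd', hd⟩ := hmaps 1 (List.mem_cons_of_mem _ (List.mem_cons_self ..))
  have hcd : c' ≠ d' := by
    rintro rfl
    have := (semiaffinePerm 17 c u e).injective (hc.symm.trans hd)
    simp at this
  simp only [semiaffinePerm_apply, map_zero, map_one, one_pow, mul_one] at hc hd
  replace hc : φ c' = c := by
    rw [hc]
    cases e <;> simp
  have hu : (u : F) = φ (d' - c') := by
    rw [map_sub, hd, hc]
    ring
  cases e
  · obtain ⟨rfl, rfl⟩ := eq_zero_one_of_affine_mem c' hc' d' hd' hcd fun z hz => by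
      obtain ⟨w, hw, hwz⟩ := hmaps z hz
      rw [semiaffinePerm_apply, ← hc, hu, cond_false, pow_one, ← map_mul, ← map_add] at hwz
      exact hφinj hwz ▸ hw
    ext x
    simp [semiaffinePerm_apply, ← hc, hu]
  · refine absurd (fun z hz => ?_) (not_conj_affine_mem c' hc' d' hd' hcd)
    obtain ⟨w, hw, hwz⟩ := hmaps z hz
    rw [semiaffinePerm_apply, ← hc, hu, cond_true, ← map_pow, ← map_mul, ← map_add,
      pow_eq_star_of_mem z hz] at hwz
    exact hφinj hwz ▸ hw

end Clique

theorem orbit_C17E (F : Type*) [Field F] [Fintype F] (hF : Fintype.card F = 289)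
    (α : F) (hα : α ^ 2 = 10) :
    (paleyOrbit ({0, 1, 4, 16, 13, α + 7, 4 * (α + 7), 16 * (α + 7),
        4 * (α + 10)} : Set F)).ncard = 83232 ∧
    (paleyOrbit ({0, 1, 4, 16, 13, α + 7, 4 * (α + 7), 16 * (α + 7),
        4 * (α + 10)} : Set F)).ncard
      = {f : Equiv.Perm F | IsPaleyAut f}.ncard := by
  have := charP_seventeen hF
  have : Fact (Nat.Prime 17) := ⟨by norm_num⟩
  have horbit := ncard_paleyOrbit_of_trivial_stab fun f (hf : IsPaleyAut f) hfC =>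
    hf.eq_refl_of_image_clique hF hα rfl hfC
  exact ⟨horbit.trans (ncard_isPaleyAut hF), horbit⟩
end
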